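/- arXiv:1810.06182 — 10 statements merged into one kernel-verified Lean document; each statement's English description precedes it below -/
import Mathlib

section
/- Let T be a tree with vertex set {1,...,n} whose edges e_1,...,e_{n-1} are assigned nonzero real weights w_1,...,w_{n-1}, and assign an arbitrary orientation to each edge. If Q is the n×(n-1) oriented vertex-edge incidence matrix of T, D is the weighted distance matrix of T, and F is the (n-1)×(n-1) diagonal matrix with diagonal entries w_1,...,w_{n-1}, then Q' D Q = -2F. -/
open Finset Matrix

noncomputable section

/-- The degree of vertex `v` in the graph `T`. -/
def degr {n : ℕ} (T : SimpleGraph (Fin n)) (v : Fin n) : ℕ := (T.neighborSet v).ncard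

/-- The weighted distance between `u` and `v`: the sum of the weights of the edges on
the unique `uv`-path in the tree `T` (edge `e i` goes from `(E i).1` to `(E i).2` and
has weight `w i`). -/
def wdist {n : ℕ} (T : SimpleGraph (Fin n)) (hc : T.Connected)
    (E : Fin (n-1) → Fin n × Fin n) (w : Fin (n-1) → ℝ) (u v : Fin n) : ℝ :=
  (((Nonempty.some (hc.preconnected u v)).toPath : T.Walk u v).edges.map
    (fun s => ∑ i : Fin (n-1), if s = s((E i).1, (E i).2) then w i else 0)).sum

/-- The weighted distance matrix. -/
def distMat {n : ℕ} (T : SimpleGraph (Fin n)) (hc : T.Connected)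
    (E : Fin (n-1) → Fin n × Fin n) (w : Fin (n-1) → ℝ) : Matrix (Fin n) (Fin n) ℝ :=
  Matrix.of fun u v => wdist T hc E w u v

/-- The squared distance matrix. -/
def sqDistMat {n : ℕ} (T : SimpleGraph (Fin n)) (hc : T.Connected)
    (E : Fin (n-1) → Fin n × Fin n) (w : Fin (n-1) → ℝ) : Matrix (Fin n) (Fin n) ℝ :=
  Matrix.of fun u v => (wdist T hc E w u v) ^ 2

/-- The weighted degree of vertex `v`: the sum of the weights of the edges incident to `v`. -/
def wdeg {n : ℕ} (E : Fin (n-1) → Fin n × Fin n) (w : Fin (n-1) → ℝ) (v : Fin n) : ℝ :=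
  ∑ k ∈ univ.filter (fun k => (E k).1 = v ∨ (E k).2 = v), w k

/-- The weighted Laplacian matrix: for `i ≠ j` the `(i,j)`-entry is `-1/w k` if `i` and `j`
are joined by the edge `e k` and `0` otherwise; diagonal entries make all row sums zero. -/
def lap {n : ℕ} (E : Fin (n-1) → Fin n × Fin n) (w : Fin (n-1) → ℝ) :
    Matrix (Fin n) (Fin n) ℝ :=
  Matrix.of fun i j =>
    if i = j then ∑ k ∈ univ.filter (fun k => (E k).1 = i ∨ (E k).2 = i), (w k)⁻¹
    else -∑ k ∈ univ.filter (fun k => E k = (i, j) ∨ E k = (j, i)), (w k)⁻¹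

/-- The oriented vertex-edge incidence matrix. -/
def incMat {n : ℕ} (E : Fin (n-1) → Fin n × Fin n) : Matrix (Fin n) (Fin (n-1)) ℝ :=
  Matrix.of fun v e => if (E e).1 = v then 1 else if (E e).2 = v then -1 else 0

/-- The edge orientation matrix: entry `(i,j)` is `1` if `e i` and `e j` are similarly
oriented (`d((E i).1, (E j).1) = d((E i).2, (E j).2)` for the unweighted distance) and
`-1` otherwise. -/
def orientMat {n : ℕ} (T : SimpleGraph (Fin n)) (E : Fin (n-1) → Fin n × Fin n) :
    Matrix (Fin (n-1)) (Fin (n-1)) ℝ :=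
  Matrix.of fun i j => if T.dist (E i).1 (E j).1 = T.dist (E i).2 (E j).2 then 1 else -1

open Classical in
theorem mem_path_edges_iff_aux {n : ℕ} (T : SimpleGraph (Fin n)) (hT : T.IsTree)
    {u v : Fin n} (p : T.Walk u v) (hp : p.IsPath) (e : Sym2 (Fin n)) :
    e ∈ p.edges ↔ ¬ (T.deleteEdges {e}).Reachable u v := by
  constructor
  · rintro he ⟨q⟩
    have hle : T.deleteEdges {e} ≤ T := T.deleteEdges_le {e}
    have h1 : (q.toPath : (T.deleteEdges {e}).Walk u v).IsPath := q.toPath.2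
    have h2 := h1.mapLe hle
    have h3 : p = (q.toPath : (T.deleteEdges {e}).Walk u v).mapLe hle :=
      congrArg Subtype.val (hT.isAcyclic.path_unique ⟨p, hp⟩ ⟨_, h2⟩)
    rw [h3, SimpleGraph.Walk.edges_mapLe_eq_edges] at he
    have h4 := SimpleGraph.Walk.edges_subset_edgeSet _ he
    simp [SimpleGraph.edgeSet_deleteEdges] at h4
  · intro h
    by_contra he
    exact h ⟨p.toDeleteEdge e he⟩

open Classical in
theorem wdist_eq_aux {n : ℕ} (T : SimpleGraph (Fin n)) (hT : T.IsTree)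
    (E : Fin (n - 1) → Fin n × Fin n) (w : Fin (n - 1) → ℝ) (u v : Fin n) :
    wdist T hT.isConnected E w u v = ∑ k : Fin (n-1),
      if (T.deleteEdges {s((E k).1, (E k).2)}).Reachable u v then 0 else w k := by
  unfold wdist
  generalize (Nonempty.some (hT.isConnected.preconnected u v)).toPath = p
  obtain ⟨p, hp⟩ := p
  rw [← List.sum_toFinset _ hp.isTrail.edges_nodup, Finset.sum_comm]
  refine Finset.sum_congr rfl fun k _ => ?_
  have := mem_path_edges_iff_aux T hT p hp s((E k).1, (E k).2)
  rw [Finset.sum_ite_eq']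
  simp only [List.mem_toFinset, this]
  split_ifs <;> first | rfl | contradiction

open Classical in
theorem inc_sum_aux {n : ℕ} (E : Fin (n - 1) → Fin n × Fin n) (j : Fin (n-1))
    (h : (E j).1 ≠ (E j).2) (f : Fin n → ℝ) :
    ∑ v, f v * incMat E v j = f (E j).1 - f (E j).2 := by
  have : ∀ v, f v * incMat E v j =
      (if (E j).1 = v then f v else 0) - (if (E j).2 = v then f v else 0) := by
    intro v
    simp only [incMat, Matrix.of_apply]
    split_ifs with h1 h2
    · exact absurd (h1.trans h2.symm) h
    all_goals simp
  simp [this, Finset.sum_sub_distrib]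

theorem stmt0 {n : ℕ} (T : SimpleGraph (Fin n)) (hT : T.IsTree)
    (E : Fin (n - 1) → Fin n × Fin n) (w : Fin (n - 1) → ℝ)
    (hw : ∀ i, w i ≠ 0)
    (hE : ∀ i, T.Adj (E i).1 (E i).2)
    (hinj : Function.Injective fun i => (s((E i).1, (E i).2) : Sym2 (Fin n)))
    (hsurj : ∀ e ∈ T.edgeSet, ∃ i, e = s((E i).1, (E i).2)) :
    (incMat E)ᵀ * distMat T hT.isConnected E w * incMat E
      = (-2 : ℝ) • Matrix.diagonal w := by
  classical
  have hne : ∀ i, (E i).1 ≠ (E i).2 := fun i => (hE i).ne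
  have key : ∀ k i, k ≠ i →
      (T.deleteEdges {s((E k).1, (E k).2)}).Reachable (E i).1 (E i).2 := by
    intro k i hki
    apply SimpleGraph.Adj.reachable
    rw [SimpleGraph.deleteEdges_adj]
    exact ⟨hE i, fun h => hki (hinj (Set.mem_singleton_iff.1 h)).symm⟩
  have key2 : ∀ k, ¬ (T.deleteEdges {s((E k).1, (E k).2)}).Reachable (E k).1 (E k).2 := by
    intro k
    rw [← mem_path_edges_iff_aux T hT (hE k).toWalk (by simp [hne k])]
    simp
  have diff : ∀ j u, wdist T hT.isConnected E w u (E j).1 - wdist T hT.isConnected E w u (E j).2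
      = (if (T.deleteEdges {s((E j).1, (E j).2)}).Reachable u (E j).1 then 0 else w j)
      - (if (T.deleteEdges {s((E j).1, (E j).2)}).Reachable u (E j).2 then 0 else w j) := by
    intro j u
    rw [wdist_eq_aux T hT, wdist_eq_aux T hT, ← Finset.sum_sub_distrib]
    refine Finset.sum_eq_single j (fun k _ hk => ?_) (by simp)
    have h := key k j hk
    have : (T.deleteEdges {s((E k).1, (E k).2)}).Reachable u (E j).1 ↔
      (T.deleteEdges {s((E k).1, (E k).2)}).Reachable u (E j).2 :=
      ⟨fun a => a.trans h, fun a => a.trans h.symm⟩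
    simp [this]
  ext i j
  rw [Matrix.mul_assoc, Matrix.mul_apply]
  have h1 : ∀ u, (distMat T hT.isConnected E w * incMat E) u j =
      wdist T hT.isConnected E w u (E j).1 - wdist T hT.isConnected E w u (E j).2 := by
    intro u
    rw [Matrix.mul_apply, inc_sum_aux E j (hne j)]
    rfl
  simp only [h1, diff, Matrix.transpose_apply]
  simp only [mul_comm (incMat E _ i)]
  rw [inc_sum_aux E i (hne i)]
  by_cases hij : i = j
  · subst hij
    have h3 := key2 i
    have h4 : ¬ (T.deleteEdges {s((E i).1, (E i).2)}).Reachable (E i).2 (E i).1 :=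
      fun h => h3 h.symm
    simp only [h3, h4, SimpleGraph.Reachable.refl, if_true, if_false, Matrix.smul_apply,
      Matrix.diagonal_apply_eq, smul_eq_mul]
    ring
  · have h := key j i (Ne.symm hij)
    have hr : ∀ x, (T.deleteEdges {s((E j).1, (E j).2)}).Reachable (E i).1 x ↔
      (T.deleteEdges {s((E j).1, (E j).2)}).Reachable (E i).2 x := fun x =>
      ⟨fun a => h.symm.trans a, fun a => h.trans a⟩
    simp [hr, hij]

end
end

section
/- Let T be a tree with vertex set {1,...,n} whose edges are assigned nonzero real weights. If L is the weighted Laplacian matrix of T and D is the weighted distance matrix of T, then L D L = -2L. -/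
open Finset Matrix

noncomputable section

theorem aux_const {V : Type*} {G : SimpleGraph V} (e : Sym2 V) (f : V → ℝ)
    (h1 : ∀ x y, G.Adj x y → s(x, y) ≠ e → f x = f y) {u v : V} (p : G.Walk u v)
    (hp : e ∉ p.edges) : f u = f v := by
  induction p with
  | nil => rfl
  | cons h p ih =>
    simp only [SimpleGraph.Walk.edges_cons, List.mem_cons, not_or] at hp
    exact (h1 _ _ h (Ne.symm hp.1)).trans (ih hp.2)

theorem aux_trail {V : Type*} [DecidableEq V] {G : SimpleGraph V} (e : Sym2 V) (f : V → ℝ) (c : ℝ)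
    (h1 : ∀ x y, G.Adj x y → s(x, y) ≠ e → f x = f y)
    (h2 : ∀ x y, s(x, y) = e → (f x - f y) ^ 2 = 1) {u v : V} (p : G.Walk u v)
    (hp : p.IsTrail) :
    (p.edges.map (fun s => if s = e then c else 0)).sum = c * (f u - f v) ^ 2 := by
  induction p with
  | nil => simp
  | @cons u x v h p ih =>
    rw [SimpleGraph.Walk.isTrail_cons] at hp
    have ih := ih hp.1
    simp only [SimpleGraph.Walk.edges_cons, List.map_cons, List.sum_cons, ih]
    by_cases he : s(u, x) = e
    · have := aux_const e f h1 p (he ▸ hp.2)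
      rw [← this, h2 _ _ he]
      simp [he]
    · rw [h1 _ _ h he]
      simp [he]

theorem aux_swap {α ι : Type*} [Fintype ι] (l : List α) (g : ι → α → ℝ) :
    (l.map (fun s => ∑ i, g i s)).sum = ∑ i, (l.map (g i)).sum := by
  induction l with
  | nil => simp
  | cons a l ih => simp [ih, Finset.sum_add_distrib]

theorem aux_fun {V : Type*} {G : SimpleGraph V} (hG : G.IsAcyclic) (a b : V) (hab : G.Adj a b) :
    ∃ f : V → ℝ, (∀ x y, G.Adj x y → s(x, y) ≠ s(a, b) → f x = f y) ∧ f a - f b = 1 := by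
  classical
  have hb := SimpleGraph.isAcyclic_iff_forall_adj_isBridge.1 hG hab
  rw [SimpleGraph.isBridge_iff] at hb
  refine ⟨fun v => if (G \ SimpleGraph.fromEdgeSet {s(a, b)}).Reachable a v then 1 else 0, ?_, ?_⟩
  · intro x y hxy hne
    have hadj : (G \ SimpleGraph.fromEdgeSet {s(a, b)}).Adj x y := by
      rw [SimpleGraph.sdiff_adj, SimpleGraph.fromEdgeSet_adj]
      exact ⟨hxy, fun h => hne h.1⟩
    have : (G \ SimpleGraph.fromEdgeSet {s(a, b)}).Reachable a x ↔
        (G \ SimpleGraph.fromEdgeSet {s(a, b)}).Reachable a y :=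
      ⟨fun h => h.trans hadj.reachable, fun h => h.trans hadj.symm.reachable⟩
    simp only [this]
  · have h0 : ¬ (G \ SimpleGraph.fromEdgeSet {s(a, b)}).Reachable a b := by
      exact hb
    simp [h0]

theorem aux_lap {n : ℕ} (E : Fin (n - 1) → Fin n × Fin n) (w : Fin (n - 1) → ℝ)
    (hE : ∀ i, (E i).1 ≠ (E i).2) :
    lap E w = incMat E * Matrix.diagonal (fun k => (w k)⁻¹) * (incMat E)ᵀ := by
  ext i j
  rw [Matrix.mul_apply]
  simp only [lap, incMat, Matrix.of_apply, Matrix.mul_diagonal, Matrix.transpose_apply]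
  by_cases hij : i = j
  · subst hij
    rw [if_pos rfl, Finset.sum_filter]
    refine Finset.sum_congr rfl fun k _ => ?_
    by_cases h1 : (E k).1 = i <;> by_cases h2 : (E k).2 = i <;> simp [h1, h2]
  · rw [if_neg hij, Finset.sum_filter, ← Finset.sum_neg_distrib]
    refine Finset.sum_congr rfl fun k _ => ?_
    have := hE k
    simp only [Prod.ext_iff]
    by_cases h1 : (E k).1 = i <;> by_cases h2 : (E k).2 = i <;> 
      by_cases h3 : (E k).1 = j <;> by_cases h4 : (E k).2 = j <;> simp [h1, h2, h3, h4] <;> grind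

theorem aux_inc {n : ℕ} (E : Fin (n - 1) → Fin n × Fin n) (hE : ∀ i, (E i).1 ≠ (E i).2)
    (k : Fin (n - 1)) (g : Fin n → ℝ) :
    ∑ v, incMat E v k * g v = g (E k).1 - g (E k).2 := by
  have : ∀ v, incMat E v k * g v =
      (if (E k).1 = v then g v else 0) - (if (E k).2 = v then g v else 0) := by
    intro v
    have := hE k
    simp only [incMat, Matrix.of_apply]
    by_cases h1 : (E k).1 = v <;> by_cases h2 : (E k).2 = v <;> simp [h1, h2]
    exact absurd (h1.trans h2.symm) this
  simp [this, Finset.sum_sub_distrib]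

theorem aux_QDQ {n : ℕ} (T : SimpleGraph (Fin n)) (hT : T.IsTree)
    (E : Fin (n - 1) → Fin n × Fin n) (w : Fin (n - 1) → ℝ)
    (hE : ∀ i, T.Adj (E i).1 (E i).2)
    (hinj : Function.Injective fun i => (s((E i).1, (E i).2) : Sym2 (Fin n))) :
    (incMat E)ᵀ * distMat T hT.isConnected E w * incMat E = Matrix.diagonal (fun k => -2 * w k) := by
  choose f hf1 hf2 using fun k => aux_fun hT.isAcyclic (E k).1 (E k).2 (hE k)
  have hd : ∀ u v, distMat T hT.isConnected E w u v = ∑ k, w k * (f k u - f k v) ^ 2 := by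
    intro u v
    simp only [distMat, wdist, Matrix.of_apply]
    rw [aux_swap]
    refine Finset.sum_congr rfl fun k _ => ?_
    refine aux_trail _ (f k) (w k) (hf1 k) ?_ _ (SimpleGraph.Path.isPath _).isTrail
    intro x y hxy
    have := hf2 k
    rcases Sym2.eq_iff.1 hxy with ⟨rfl, rfl⟩ | ⟨rfl, rfl⟩
    · rw [this]; norm_num
    · rw [← neg_sub, this]; norm_num
  have hne : ∀ i, (E i).1 ≠ (E i).2 := fun i => (hE i).ne
  have hδ : ∀ k i, f k (E i).1 - f k (E i).2 = if k = i then 1 else 0 := by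
    intro k i
    split_ifs with h
    · subst h; exact hf2 k
    · exact sub_eq_zero.2 (hf1 k _ _ (hE i) fun h' => h (hinj h').symm)
  ext i j
  rw [Matrix.mul_apply]
  simp only [Matrix.mul_apply, Matrix.transpose_apply, aux_inc E hne]
  simp only [mul_comm _ (incMat E _ j), aux_inc E hne]
  simp only [hd, ← Finset.sum_sub_distrib]
  have : ∀ k, w k * (f k (E i).1 - f k (E j).1) ^ 2 - w k * (f k (E i).2 - f k (E j).1) ^ 2 -
      (w k * (f k (E i).1 - f k (E j).2) ^ 2 - w k * (f k (E i).2 - f k (E j).2) ^ 2) =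
      -2 * w k * ((if k = i then 1 else 0) * (if k = j then 1 else 0)) := by
    intro k
    rw [← hδ, ← hδ]; ring
  simp only [this]
  by_cases hij : i = j
  · subst hij; simp
  · simp [hij, Ne.symm hij]

theorem stmt1 {n : ℕ} (T : SimpleGraph (Fin n)) (hT : T.IsTree)
    (E : Fin (n - 1) → Fin n × Fin n) (w : Fin (n - 1) → ℝ)
    (hw : ∀ i, w i ≠ 0)
    (hE : ∀ i, T.Adj (E i).1 (E i).2)
    (hinj : Function.Injective fun i => (s((E i).1, (E i).2) : Sym2 (Fin n)))
    (hsurj : ∀ e ∈ T.edgeSet, ∃ i, e = s((E i).1, (E i).2)) :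
    lap E w * distMat T hT.isConnected E w * lap E w = (-2 : ℝ) • lap E w := by
  rw [aux_lap E w fun i => (hE i).ne]
  set Q := incMat E with hQ
  have h := aux_QDQ T hT E w hE hinj
  rw [← hQ] at h
  set W := Matrix.diagonal (fun k => (w k)⁻¹) with hW
  set D := distMat T hT.isConnected E w
  have : Q * W * Qᵀ * D * (Q * W * Qᵀ) = Q * (W * (Qᵀ * D * Q) * W) * Qᵀ := by
    simp only [Matrix.mul_assoc]
  rw [this, h, hW, Matrix.diagonal_mul_diagonal, Matrix.diagonal_mul_diagonal]
  have h3 : (fun i => (w i)⁻¹ * (-2 * w i) * (w i)⁻¹) = (-2 : ℝ) • fun i => (w i)⁻¹ := by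
    ext i
    have := hw i
    simp only [Pi.smul_apply, smul_eq_mul]
    field_simp
  rw [h3, Matrix.diagonal_smul, Matrix.mul_smul, Matrix.smul_mul]

end
end

section
/- Let T be a tree with vertex set {1,...,n} whose edges e_1,...,e_{n-1} are assigned nonzero real weights w_1,...,w_{n-1}, and let D be the weighted distance matrix of T. Then det D = (-1)^{n-1} 2^{n-2} (w_1 + ... + w_{n-1}) (w_1 ⋯ w_{n-1}). -/
open Finset Matrix

noncomputable section

/-- A unitriangular matrix (with respect to a height function) has determinant one. -/
theorem det_unitri {V : Type*} [Fintype V] [DecidableEq V] (M : Matrix V V ℝ) (b : V → ℕ)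
    (h1 : ∀ i, M i i = 1) (h2 : ∀ i j, i ≠ j → b j ≤ b i → M i j = 0) : M.det = 1 := by
  have hb : M.BlockTriangular b := by
    intro i j hij
    exact h2 i j (by rintro rfl; exact lt_irrefl _ hij) hij.le
  rw [hb.det]
  apply Finset.prod_eq_one
  intro k _
  have : M.toSquareBlock b k = 1 := by
    ext ⟨i, hi⟩ ⟨j, hj⟩
    by_cases hij : i = j
    · subst hij
      simp [Matrix.toSquareBlock_def, h1]
    · rw [Matrix.one_apply_ne (by simpa using hij)]
      simp only [Matrix.toSquareBlock_def, Matrix.of_apply]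
      exact h2 i j hij (by rw [hi, hj])
  rw [this, Matrix.det_one]

/-- Rooted structure of a tree. -/
theorem tree_root {V : Type*} [DecidableEq V] (T : SimpleGraph V) (hT : T.IsTree) (r : V) :
    ∃ (S : V → V → Prop) (par : V → V) (dep : V → ℕ),
      (∀ x, S x x) ∧ (∀ x, S x r) ∧
      (∀ x, x ≠ r → T.Adj x (par x) ∧ (∀ v, S x v ↔ v = x ∨ S (par x) v) ∧ ¬ S (par x) x
        ∧ dep (par x) < dep x) ∧
      (∀ x v, S x v → v = x ∨ dep v < dep x) ∧
      (∀ x y, T.Adj x y → (x ≠ r ∧ y = par x) ∨ (y ≠ r ∧ x = par y)) ∧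
      (∀ x y (q : T.Walk x y) v, S x v → v ∈ q.support ∨ S y v) ∧
      (∀ x y (q : T.Walk x y), q.IsPath → ∀ v ∈ q.support, S x v ∨ S y v) := by
  classical
  have huniq : ∀ {x y : V} (p q : T.Walk x y), p.IsPath → q.IsPath → p = q := fun p q hp hq =>
    congrArg Subtype.val (hT.isAcyclic.path_unique ⟨p, hp⟩ ⟨q, hq⟩)
  have hsub : ∀ {x y : V} (p q : T.Walk x y), p.IsPath → ∀ v ∈ p.support, v ∈ q.support := by
    intro x y p q hp v hv
    rw [huniq p q.bypass hp q.bypass_isPath] at hv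
    exact q.support_bypass_subset hv
  have hex : ∀ x, ∃ p : T.Walk x r, p.IsPath := fun x =>
    (hT.isConnected.preconnected x r).exists_isPath
  choose P hP using hex
  have hdrop : ∀ x v (hv : v ∈ (P x).support), (P x).dropUntil v hv = P v := fun x v hv =>
    huniq _ _ ((hP x).dropUntil hv) (hP v)
  have hlen : ∀ x v, v ∈ (P x).support → v = x ∨ (P v).length < (P x).length := by
    intro x v hv
    by_cases h : v = x
    · exact Or.inl h
    · right
      have h1 := congrArg SimpleGraph.Walk.length ((P x).take_spec hv)
      rw [SimpleGraph.Walk.length_append, hdrop] at h1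
      have h2 : ((P x).takeUntil v hv).length ≠ 0 := fun h0 =>
        h (SimpleGraph.Walk.eq_of_length_eq_zero h0).symm
      omega
  have hpar : ∀ x, ∃ y, x ≠ r → ∃ h : T.Adj x y, P x = SimpleGraph.Walk.cons h (P y) := by
    intro x
    by_cases hx : x = r
    · exact ⟨x, fun h => absurd hx h⟩
    · have key : ∀ (p : T.Walk x r), p.IsPath →
          ∃ y, ∃ h : T.Adj x y, p = SimpleGraph.Walk.cons h (P y) := by
        intro p hp
        cases p with
        | nil => exact absurd rfl hx
        | cons h q =>
          refine ⟨_, h, ?_⟩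
          rw [huniq q (P _) hp.of_cons (hP _)]
      obtain ⟨y, h⟩ := key (P x) (hP x)
      exact ⟨y, fun _ => h⟩
  choose par hpar using hpar
  have hstep : ∀ x y (h : T.Adj x y), x ∉ (P y).support → x ≠ r ∧ y = par x := by
    intro x y h hx
    have hxr : x ≠ r := by rintro rfl; exact hx (P y).end_mem_support
    refine ⟨hxr, ?_⟩
    obtain ⟨h', he⟩ := hpar x hxr
    have h1 := huniq (P x) (SimpleGraph.Walk.cons h (P y)) (hP x) ((hP y).cons hx)
    rw [he] at h1
    have h2 := congrArg SimpleGraph.Walk.snd h1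
    simpa using h2.symm
  refine ⟨fun x v => v ∈ (P x).support, par, fun x => (P x).length, fun x => by simp,
    fun x => by simp, ?_, hlen, ?_, ?_, ?_⟩
  · intro x hx
    obtain ⟨h, he⟩ := hpar x hx
    have hp := hP x
    rw [he, SimpleGraph.Walk.cons_isPath_iff] at hp
    refine ⟨h, fun v => ?_, hp.2, ?_⟩
    · show v ∈ (P x).support ↔ v = x ∨ v ∈ (P (par x)).support
      rw [he]; simp
    · show (P (par x)).length < (P x).length
      rw [he]; simp
  · intro x y h
    by_cases hx : x ∈ (P y).support
    · right
      apply hstep y x h.symm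
      intro hy
      rcases hlen y x hx with h1 | h1
      · exact h.ne h1
      · rcases hlen x y hy with h2 | h2
        · exact h.ne h2.symm
        · omega
    · exact Or.inl (hstep x y h hx)
  · intro x y q v hv
    have := hsub (P x) (q.append (P y)) (hP x) v hv
    rwa [SimpleGraph.Walk.mem_support_append_iff] at this
  · intro x y q hq v hv
    have := hsub q ((P x).append (P y).reverse) hq v hv
    rw [SimpleGraph.Walk.mem_support_append_iff] at this
    simpa using this

/-- The determinant formula relative to a rooted structure. -/
theorem root_det {V : Type*} [Fintype V] [DecidableEq V] (T : SimpleGraph V) (hT : T.IsTree)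
    (r : V) (W : Sym2 V → ℝ) (D : Matrix V V ℝ)
    (hD : ∀ x y, ∃ p : T.Walk x y, p.IsPath ∧ D x y = (p.edges.map W).sum) :
    ∃ par : V → V, (∀ x, x ≠ r → T.Adj x (par x)) ∧
      (∀ x y, x ≠ r → y ≠ r → s(x, par x) = s(y, par y) → x = y) ∧
      D.det = (1 / 2 * ∑ v : {v // v ≠ r}, W s(v.1, par v.1)) *
        ∏ v : {v // v ≠ r}, (-2 * W s(v.1, par v.1)) := by
  classical
  obtain ⟨S, par, dep, hS1, hSr, hpar, hdep, hadj, hwalk, hpath⟩ := tree_root T hT r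
  refine ⟨par, fun x hx => (hpar x hx).1, ?_, ?_⟩
  · intro x y hx hy h
    rw [Sym2.eq_iff] at h
    rcases h with h | h
    · exact h.1
    · have h1 := (hpar x hx).2.2.2
      have h2 := (hpar y hy).2.2.2
      rw [h.2] at h1
      rw [← h.1] at h2
      omega
  set c : V → V → ℝ := fun x v => if S x v then 1 else 0 with hc
  set a : V → ℝ := fun v => if v = r then 0 else W s(v, par v) with ha
  have hsum : ∀ x y (p : T.Walk x y), p.IsPath →
      (p.edges.map W).sum = ∑ v, a v * (c x v - c y v) ^ 2 := by
    intro x y p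
    induction p with
    | nil => intro _; simp
    | @cons x x' y h p ih =>
      intro hp
      have hp' := hp
      rw [SimpleGraph.Walk.cons_isPath_iff] at hp
      rw [SimpleGraph.Walk.edges_cons, List.map_cons, List.sum_cons, ih hp.1]
      rcases hadj x x' h with ⟨hr, he⟩ | ⟨hr, he⟩
      · obtain ⟨-, h1, h2, -⟩ := hpar x hr
        rw [← he] at h1 h2
        have h3 : ¬ S y x := by
          intro h3
          rcases hwalk y x' p.reverse x h3 with h4 | h4
          · exact hp.2 (by simpa using h4)
          · exact h2 h4
        have : W s(x, x') = ∑ v, if v = x then W s(x, x') else 0 := by simp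
        rw [this, ← Finset.sum_add_distrib]
        refine Finset.sum_congr rfl fun v _ => ?_
        by_cases hv : v = x
        · subst hv
          simp [hc, ha, h2, h3, hS1, hr, ← he]
        · simp [hc, h1, hv]
      · obtain ⟨-, h1, h2, -⟩ := hpar x' hr
        rw [← he] at h1 h2
        have h3 : S y x' := by
          rcases hpath x y _ hp' x' (by simp) with h4 | h4
          · exact absurd h4 h2
          · exact h4
        have : W s(x, x') = ∑ v, if v = x' then W s(x, x') else 0 := by simp
        rw [this, ← Finset.sum_add_distrib]
        refine Finset.sum_congr rfl fun v _ => ?_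
        by_cases hv : v = x'
        · subst hv
          simp [hc, ha, h2, h3, hS1, hr, ← he, Sym2.eq_swap]
        · simp [hc, h1, hv]
  set s : ℝ := 1 / 2 * ∑ v : {v // v ≠ r}, W s(v.1, par v.1) with hs
  have hs' : s = 1 / 2 * ∑ v, a v := by
    rw [hs, Fintype.sum_eq_add_sum_subtype_ne a r]
    congr 1
    have : a r = 0 := by simp [ha]
    rw [this, zero_add]
    exact Finset.sum_congr rfl fun v _ => by simp [ha, v.2]
  let C : Matrix V V ℝ := Matrix.of fun v x => c x v
  let X : Matrix V V ℝ := Matrix.of fun i j => if i = j then 1 else if i = r then -1 / 2 else 0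
  let d : V → ℝ := fun v => if v = r then s else -2 * a v
  have hC : C.det = 1 := by
    apply det_unitri C dep
    · intro i; simp [C, hc, hS1]
    · intro i j hij hd
      simp only [C, hc, Matrix.of_apply]
      rw [if_neg]
      intro h
      rcases hdep j i h with h | h
      · exact hij h
      · omega
  have hX : X.det = 1 := by
    apply det_unitri X (fun v => if v = r then 0 else 1)
    · intro i; simp [X]
    · intro i j hij hd
      by_cases hi : i = r
      · have : j ≠ r := fun h => hij (hi.trans h.symm)
        simp [hi, this] at hd
      · simp [X, hij, hi]
  have hB : ∀ x v, (Cᵀ * X) x v = if v = r then 1 else c x v - 1 / 2 := by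
    intro x v
    rw [Matrix.mul_apply]
    by_cases hv : v = r
    · subst hv
      rw [Finset.sum_eq_single v]
      · simp [C, X, hc, hSr]
      · intro b _ hb
        simp [X, hb]
      · simp
    · rw [Finset.sum_eq_add_of_mem v r (Finset.mem_univ _) (Finset.mem_univ _) hv]
      · simp [C, X, hc, hSr, hv, Ne.symm hv]
        ring
      · intro b _ hb
        simp [X, hb.1, hb.2]
  have hfac : D = (Cᵀ * X) * Matrix.diagonal d * (Cᵀ * X)ᵀ := by
    ext x y
    obtain ⟨p, hp, hDp⟩ := hD x y
    rw [hDp, hsum x y p hp, Matrix.mul_apply]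
    simp only [Matrix.mul_diagonal, Matrix.transpose_apply, hB]
    have h1 : ∀ v, ((if v = r then (1:ℝ) else c x v - 1 / 2) * d v *
        (if v = r then 1 else c y v - 1 / 2)) =
        (if v = r then s else 0) - 2 * a v * (c x v - 1 / 2) * (c y v - 1 / 2) := by
      intro v
      by_cases hv : v = r
      · simp [hv, d, ha]
      · simp only [hv, d, if_false]; ring
    simp only [h1]
    rw [Finset.sum_sub_distrib, Finset.sum_ite_eq' Finset.univ r, if_pos (Finset.mem_univ _), hs',
      Finset.mul_sum, ← Finset.sum_sub_distrib]
    refine Finset.sum_congr rfl fun v _ => ?_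
    simp only [hc]
    split_ifs <;> ring
  rw [hfac]
  simp only [Matrix.det_mul, Matrix.det_transpose, hC, hX, Matrix.det_diagonal]
  rw [Fintype.prod_eq_mul_prod_subtype_ne d r]
  have hdr : d r = s := by simp [d]
  rw [hdr]
  simp only [one_mul, mul_one]
  congr 1
  exact Finset.prod_congr rfl fun v _ => by simp [d, ha, v.2]

theorem stmt2 {n : ℕ} (T : SimpleGraph (Fin n)) (hT : T.IsTree)
    (E : Fin (n - 1) → Fin n × Fin n) (w : Fin (n - 1) → ℝ)
    (hw : ∀ i, w i ≠ 0)
    (hE : ∀ i, T.Adj (E i).1 (E i).2)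
    (hinj : Function.Injective fun i => (s((E i).1, (E i).2) : Sym2 (Fin n)))
    (hsurj : ∀ e ∈ T.edgeSet, ∃ i, e = s((E i).1, (E i).2)) :
    (distMat T hT.isConnected E w).det
      = (-1 : ℝ) ^ (n - 1) * (2 : ℝ) ^ ((n : ℤ) - 2) * (∑ i, w i) * (∏ i, w i) := by
  classical
  obtain ⟨r⟩ := hT.isConnected.nonempty
  set W : Sym2 (Fin n) → ℝ :=
    fun s => ∑ i : Fin (n-1), if s = s((E i).1, (E i).2) then w i else 0 with hW
  obtain ⟨par, hadj, hpinj, hdet⟩ := root_det T hT r W (distMat T hT.isConnected E w) (by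
    intro x y
    exact ⟨_, ((Nonempty.some (hT.isConnected.preconnected x y)).toPath).2, rfl⟩)
  have hWE : ∀ i, W s((E i).1, (E i).2) = w i := by
    intro i
    simp only [hW]
    rw [Finset.sum_eq_single i]
    · simp
    · intro j _ hj
      rw [if_neg]
      intro h
      exact hj (hinj h).symm
    · simp
  have hex : ∀ v : {v // v ≠ r}, ∃ i, s(v.1, par v.1) = s((E i).1, (E i).2) := fun v =>
    hsurj _ (hadj v.1 v.2)
  choose f hf using hex
  have hfi : Function.Injective f := by
    intro u v huv
    apply Subtype.ext
    apply hpinj _ _ u.2 v.2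
    rw [hf, hf, huv]
  have hcard : Fintype.card {v // v ≠ r} = Fintype.card (Fin (n-1)) := by
    simp
  have hfb : Function.Bijective f := (Fintype.bijective_iff_injective_and_card f).2 ⟨hfi, hcard⟩
  have hWf : ∀ v : {v // v ≠ r}, W s(v.1, par v.1) = w (f v) := fun v => by rw [hf, hWE]
  rw [hdet]
  simp only [hWf]
  rw [hfb.sum_comp w, hfb.prod_comp (fun i => -2 * w i), Finset.prod_mul_distrib]
  simp only [Finset.prod_const, Finset.card_univ, Fintype.card_fin]
  have hn : 1 ≤ n := by have := r.2; omega
  have h2 : (2:ℝ) ^ ((n:ℤ) - 2) = 2 ^ (n-1) * (1/2) := by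
    have : (n:ℤ) - 2 = ((n-1 : ℕ) : ℤ) - 1 := by omega
    rw [this, zpow_sub_one₀ (by norm_num), zpow_natCast]
    norm_num
  rw [h2, show (-2:ℝ) = -1 * 2 by norm_num, mul_pow]
  ring

end
end

section
/- Let T be a tree with vertex set {1,...,n} whose edges e_1,...,e_{n-1} are assigned nonzero real weights w_1,...,w_{n-1}, let D be the weighted distance matrix and L the weighted Laplacian of T, and let τ be the n×1 vector with i-th component τ_i = 2 - δ_i, where δ_i is the degree of vertex i. If w_1 + ... + w_{n-1} ≠ 0, then D is nonsingular and D^{-1} = -(1/2) L + (1/(2(w_1+...+w_{n-1}))) τ τ'. -/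
open Finset Matrix

noncomputable section

/-- Path structure of a tree rooted at `u`: each edge `k` has a child end `c k` and a parent
end `p k`. -/
theorem exists_root {n : ℕ} (T : SimpleGraph (Fin n)) (hT : T.IsTree)
    (E : Fin (n - 1) → Fin n × Fin n) (w : Fin (n - 1) → ℝ)
    (hE : ∀ i, T.Adj (E i).1 (E i).2)
    (hinj : Function.Injective fun i => (s((E i).1, (E i).2) : Sym2 (Fin n)))
    (u : Fin n) :
    ∃ c p : Fin (n - 1) → Fin n, (∀ k, E k = (c k, p k) ∨ E k = (p k, c k)) ∧
      (∀ k, wdist T hT.isConnected E w u (c k) = wdist T hT.isConnected E w u (p k) + w k) ∧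
      Function.Injective c ∧ (∀ k, c k ≠ u) ∧ wdist T hT.isConnected E w u u = 0 := by
  classical
  let P : ∀ v, T.Walk u v := fun v =>
    ((Nonempty.some (hT.isConnected.preconnected u v)).toPath : T.Walk u v)
  have hP : ∀ v, (P v).IsPath := fun v =>
    ((Nonempty.some (hT.isConnected.preconnected u v)).toPath).2
  have hd : ∀ v, wdist T hT.isConnected E w u v = ((P v).edges.map
    (fun s => ∑ i : Fin (n-1), if s = s((E i).1, (E i).2) then w i else 0)).sum := fun v => rfl
  have hac := hT.isAcyclic
  have hu : P u = SimpleGraph.Walk.nil := by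
    have := hP u
    exact SimpleGraph.Walk.isPath_iff_eq_nil.1 this
  have key : ∀ k, ∃ cp : Fin n × Fin n, (E k = (cp.1, cp.2) ∨ E k = (cp.2, cp.1)) ∧
      ∃ h : T.Adj cp.2 cp.1, P cp.1 = (P cp.2).concat h := by
    intro k
    by_cases hm : (E k).1 ∈ (P (E k).2).support
    · exact ⟨((E k).2, (E k).1), Or.inr rfl, hE k,
        hac.path_concat (hP _) (hP _) (hE k) hm⟩
    · have := hac.mem_support_of_ne_mem_support_of_adj_of_isPath (hP _) (hP _) (hE k) hm
      exact ⟨((E k).1, (E k).2), Or.inl rfl, (hE k).symm,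
        hac.path_concat (hP _) (hP _) (hE k).symm this⟩
  choose cp h1 h2 h3 using key
  have hs : ∀ k, s((E k).1, (E k).2) = s((cp k).2, (cp k).1) := by
    intro k
    rcases h1 k with h | h
    · rw [h]; exact Sym2.eq_swap
    · rw [h]
  have hpen : ∀ k, (P (cp k).1).penultimate = (cp k).2 := by
    intro k
    rw [h3 k, SimpleGraph.Walk.penultimate_concat]
  refine ⟨fun k => (cp k).1, fun k => (cp k).2, h1, ?_, ?_, ?_, ?_⟩
  · intro k
    rw [hd, hd, h3 k, SimpleGraph.Walk.edges_concat, List.concat_eq_append, List.map_append,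
      List.sum_append]
    congr 1
    simp only [List.map_cons, List.map_nil, List.sum_cons, List.sum_nil, add_zero, ← hs k]
    rw [Finset.sum_eq_single k]
    · simp
    · intro b _ hb
      rw [if_neg]
      intro h
      exact hb (hinj h).symm
    · simp
  · intro k l hkl
    have hkl' : (cp k).1 = (cp l).1 := hkl
    have e2 : (cp k).2 = (cp l).2 := by rw [← hpen k, ← hpen l, hkl']
    apply hinj
    show s((E k).1, (E k).2) = s((E l).1, (E l).2)
    rw [hs, hs, hkl', e2]
  · intro k hk
    have h4 := congrArg SimpleGraph.Walk.length (h3 k)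
    rw [SimpleGraph.Walk.length_concat] at h4
    have h5 : ∀ v, v = u → (P v).length = 0 := by
      rintro v rfl
      rw [hu]; rfl
    have h6 : (P (cp k).1).length = 0 := h5 _ hk
    omega
  · rw [hd, hu]; simp

theorem lap_eq {n : ℕ} (E : Fin (n - 1) → Fin n × Fin n) (w : Fin (n - 1) → ℝ)
    (hne : ∀ i, (E i).1 ≠ (E i).2) (c p : Fin (n - 1) → Fin n)
    (h1 : ∀ k, E k = (c k, p k) ∨ E k = (p k, c k)) (i j : Fin n) :
    lap E w i j = ∑ k, (w k)⁻¹ * ((if c k = i then 1 else 0) - (if p k = i then 1 else 0))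
      * ((if c k = j then 1 else 0) - (if p k = j then 1 else 0)) := by
  have hcp : ∀ k, c k ≠ p k := by
    intro k h
    have := hne k
    rcases h1 k with h' | h' <;> rw [h'] at this <;> simp_all
  unfold lap
  simp only [Matrix.of_apply]
  split_ifs with hij
  · subst hij
    rw [Finset.sum_filter]
    refine Finset.sum_congr rfl fun k _ => ?_
    have := hcp k
    rcases h1 k with h' | h' <;> rw [h'] <;> simp only [] <;>
      by_cases ha : c k = i <;> by_cases hb : p k = i <;> simp_all
  · rw [Finset.sum_filter, ← Finset.sum_neg_distrib]
    refine Finset.sum_congr rfl fun k _ => ?_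
    have := hcp k
    rcases h1 k with h' | h' <;> rw [h'] <;> simp only [Prod.mk.injEq] <;>
      by_cases ha : c k = i <;> by_cases hb : p k = i <;> by_cases hc : c k = j <;>
      by_cases hd : p k = j <;> simp_all

theorem degr_eq {n : ℕ} (T : SimpleGraph (Fin n))
    (E : Fin (n - 1) → Fin n × Fin n)
    (hE : ∀ i, T.Adj (E i).1 (E i).2)
    (hinj : Function.Injective fun i => (s((E i).1, (E i).2) : Sym2 (Fin n)))
    (hsurj : ∀ e ∈ T.edgeSet, ∃ i, e = s((E i).1, (E i).2)) (c p : Fin (n - 1) → Fin n)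
    (h1 : ∀ k, E k = (c k, p k) ∨ E k = (p k, c k)) (v : Fin n) :
    (degr T v : ℝ) = ∑ k, ((if c k = v then 1 else 0) + (if p k = v then 1 else 0)) := by
  classical
  have hs : ∀ k, s((E k).1, (E k).2) = s(c k, p k) := by
    intro k
    rcases h1 k with h | h
    · rw [h]
    · rw [h]; exact Sym2.eq_swap
  have hadj : ∀ k, T.Adj (c k) (p k) := by
    intro k
    have := hE k
    rw [← SimpleGraph.mem_edgeSet, hs] at this
    exact this
  have hcp : ∀ k, c k ≠ p k := fun k => (hadj k).ne
  have hdeg : degr T v = (univ.filter fun k => c k = v ∨ p k = v).card := by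
    unfold degr
    rw [← Set.ncard_coe_finset]
    symm
    refine Set.ncard_congr (fun k _ => if c k = v then p k else c k) ?_ ?_ ?_
    · intro k hk
      have := hadj k
      simp only [coe_filter, mem_univ, true_and, Set.mem_setOf_eq] at hk
      rw [SimpleGraph.mem_neighborSet]
      split_ifs with h
      · rwa [← h]
      · rw [← hk.resolve_left h]; exact this.symm
    · intro k l hk hl hkl
      simp only [coe_filter, mem_univ, true_and, Set.mem_setOf_eq] at hk hl
      apply hinj
      show s((E k).1, (E k).2) = s((E l).1, (E l).2)
      rw [hs, hs, Sym2.eq_iff]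
      split_ifs at hkl with a b b
      · exact Or.inl ⟨a.trans b.symm, hkl⟩
      · exact Or.inr ⟨a.trans (hl.resolve_left b).symm, hkl⟩
      · exact Or.inr ⟨hkl, (hk.resolve_left a).trans b.symm⟩
      · exact Or.inl ⟨hkl, (hk.resolve_left a).trans (hl.resolve_left b).symm⟩
    · intro x hx
      obtain ⟨k, hk⟩ := hsurj s(v, x) hx
      rw [hs, Sym2.eq_iff] at hk
      have := hcp k
      rcases hk with ⟨a, b⟩ | ⟨a, b⟩
      · exact ⟨k, by simp [a], by simp [a, b]⟩
      · refine ⟨k, by simp [a], ?_⟩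
        rw [if_neg (by rw [a]; exact this), b]
  rw [hdeg, Finset.card_filter]
  push_cast
  refine Finset.sum_congr rfl fun k _ => ?_
  have := hcp k
  by_cases a : c k = v <;> by_cases b : p k = v <;> simp_all

theorem sum_child {n : ℕ} (c : Fin (n - 1) → Fin n) (hc : Function.Injective c) (u : Fin n)
    (hu : ∀ k, c k ≠ u) (f : Fin n → ℝ) : ∑ v, f v = f u + ∑ k, f (c k) := by
  classical
  have him : univ.image c = univ.erase u := by
    apply Finset.eq_of_subset_of_card_le
    · intro x hx
      obtain ⟨k, -, rfl⟩ := Finset.mem_image.1 hx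
      exact Finset.mem_erase.2 ⟨hu k, mem_univ _⟩
    · rw [Finset.card_image_of_injective _ hc, Finset.card_erase_of_mem (mem_univ _)]
      simp
  rw [← Finset.add_sum_erase _ _ (mem_univ u), ← him, Finset.sum_image (hc.injOn)]

theorem stmt3 {n : ℕ} (T : SimpleGraph (Fin n)) (hT : T.IsTree)
    (E : Fin (n - 1) → Fin n × Fin n) (w : Fin (n - 1) → ℝ)
    (hw : ∀ i, w i ≠ 0)
    (hE : ∀ i, T.Adj (E i).1 (E i).2)
    (hinj : Function.Injective fun i => (s((E i).1, (E i).2) : Sym2 (Fin n)))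
    (hsurj : ∀ e ∈ T.edgeSet, ∃ i, e = s((E i).1, (E i).2))
    (hsw : (∑ i, w i) ≠ 0) :
    (distMat T hT.isConnected E w).det ≠ 0 ∧
      (distMat T hT.isConnected E w)⁻¹
        = (-(1 / 2) : ℝ) • lap E w
          + (1 / (2 * ∑ i, w i)) • Matrix.vecMulVec (fun v => 2 - (degr T v : ℝ)) (fun v => 2 - (degr T v : ℝ)) := by
  have hmul : distMat T hT.isConnected E w * ((-(1 / 2) : ℝ) • lap E w
          + (1 / (2 * ∑ i, w i)) • Matrix.vecMulVec (fun v => 2 - (degr T v : ℝ)) (fun v => 2 - (degr T v : ℝ))) = 1 := by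
    ext u v
    obtain ⟨c, p, h1, h2, hc, hu, h0⟩ := exists_root T hT E w hE hinj u
    have hL := lap_eq E w (fun i => (hE i).ne) c p h1
    have hdg := degr_eq T E hE hinj hsurj c p h1
    have hA : ∑ x, wdist T hT.isConnected E w u x * lap E w x v
        = 2 - (degr T v : ℝ) - 2 * (if u = v then 1 else 0) := by
      have e1 : ∑ x, wdist T hT.isConnected E w u x * lap E w x v
          = ∑ k, ((if c k = v then (1:ℝ) else 0) - (if p k = v then 1 else 0)) := by
        simp only [hL, Finset.mul_sum]
        rw [Finset.sum_comm]
        refine Finset.sum_congr rfl fun k _ => ?_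
        have e2 : ∑ x, wdist T hT.isConnected E w u x
            * ((if c k = x then (1:ℝ) else 0) - (if p k = x then 1 else 0)) = w k := by
          simp only [mul_sub, Finset.sum_sub_distrib, mul_ite, mul_one, mul_zero,
            Finset.sum_ite_eq, mem_univ, if_true]
          rw [h2]; ring
        have e3 : ∀ b : ℝ, ∑ x, wdist T hT.isConnected E w u x * ((w k)⁻¹
            * ((if c k = x then (1:ℝ) else 0) - (if p k = x then 1 else 0)) * b) = b := by
          intro b
          calc _ = (w k)⁻¹ * b * ∑ x, wdist T hT.isConnected E w u x
            * ((if c k = x then (1:ℝ) else 0) - (if p k = x then 1 else 0)) := by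
                rw [Finset.mul_sum]
                exact Finset.sum_congr rfl fun x _ => by ring
            _ = b := by
              rw [e2]
              have := hw k
              field_simp
        exact e3 _
      have e4 := sum_child c hc u hu (fun x => if x = v then (1:ℝ) else 0)
      rw [e1, hdg]
      simp only [Finset.sum_ite_eq', mem_univ, if_true] at e4
      rw [Finset.sum_sub_distrib, Finset.sum_add_distrib]
      linarith
    have hB : ∑ x, wdist T hT.isConnected E w u x * (2 - (degr T x : ℝ)) = ∑ k, w k := by
      have e4 := sum_child c hc u hu (fun x => wdist T hT.isConnected E w u x)
      have e5 : ∑ x, wdist T hT.isConnected E w u x * (degr T x : ℝ)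
          = ∑ k, (wdist T hT.isConnected E w u (c k) + wdist T hT.isConnected E w u (p k)) := by
        simp only [hdg, Finset.mul_sum]
        rw [Finset.sum_comm]
        refine Finset.sum_congr rfl fun k _ => ?_
        simp only [mul_add, Finset.sum_add_distrib, mul_ite, mul_one, mul_zero,
            Finset.sum_ite_eq, mem_univ, if_true]
      simp only [mul_sub, Finset.sum_sub_distrib]
      rw [e5, ← Finset.sum_mul, e4, h0, Finset.sum_add_distrib]
      simp only [h2, Finset.sum_add_distrib]
      ring
    rw [Matrix.mul_apply]
    simp only [distMat, Matrix.of_apply, Matrix.add_apply, Matrix.smul_apply, smul_eq_mul,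
      Matrix.vecMulVec_apply]
    calc _ = -(1/2) * ∑ x, wdist T hT.isConnected E w u x * lap E w x v
          + (1 / (2 * ∑ i, w i)) * (2 - (degr T v : ℝ))
            * ∑ x, wdist T hT.isConnected E w u x * (2 - (degr T x : ℝ)) := by
          generalize (1 / (2 * ∑ i, w i)) = q
          rw [Finset.mul_sum, Finset.mul_sum, ← Finset.sum_add_distrib]
          exact Finset.sum_congr rfl fun x _ => by ring
      _ = _ := by
          rw [hA, hB, Matrix.one_apply]
          split_ifs <;> field_simp <;> ring
  refine ⟨?_, Matrix.inv_eq_right_inv hmul⟩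
  intro h
  have := congrArg Matrix.det hmul
  rw [Matrix.det_mul, h] at this
  simp at this

end
end

section
/- Let T be a tree with vertex set {1,...,n} whose edges e_1,...,e_{n-1} are assigned nonzero real weights w_1,...,w_{n-1}, let D be the weighted distance matrix of T, and let τ be the n×1 vector with i-th component τ_i = 2 - δ_i, where δ_i is the degree of vertex i. Then D τ = (w_1 + ... + w_{n-1}) 𝟙, where 𝟙 is the all-ones vector. -/
open Finset Matrix

noncomputable section

lemma wdist_eq {n : ℕ} (T : SimpleGraph (Fin n)) (hT : T.IsTree)
    (E : Fin (n - 1) → Fin n × Fin n) (w : Fin (n - 1) → ℝ) (u v : Fin n)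
    (p : T.Walk u v) (hp : p.IsPath) :
    wdist T hT.isConnected E w u v = (p.edges.map
    (fun s => ∑ i : Fin (n-1), if s = s((E i).1, (E i).2) then w i else 0)).sum := by
  unfold wdist
  have := hT.isAcyclic.path_unique (Nonempty.some (hT.isConnected.preconnected u v)).toPath ⟨p, hp⟩
  rw [this]

lemma parent_exists {n : ℕ} (T : SimpleGraph (Fin n)) (hT : T.IsTree)
    (E : Fin (n - 1) → Fin n × Fin n) (w : Fin (n - 1) → ℝ) (r : Fin n) :
    ∃ (L : Fin n → ℕ), ∀ v, v ≠ r → ∃ u, T.Adj v u ∧ L v = L u + 1 ∧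
      wdist T hT.isConnected E w r v = wdist T hT.isConnected E w r u +
        ∑ i : Fin (n-1), if s(v,u) = s((E i).1, (E i).2) then w i else 0 := by
  refine ⟨fun v => ((Nonempty.some (hT.isConnected.preconnected v r)).toPath : T.Walk v r).length, ?_⟩
  intro v hv
  rcases h : (Nonempty.some (hT.isConnected.preconnected v r)).toPath with ⟨p, hp⟩
  cases p with
  | nil => exact absurd rfl hv
  | @cons _ u _ hadj q =>
    have hq : q.IsPath := hp.of_cons
    refine ⟨u, hadj, ?_, ?_⟩
    · have := hT.isAcyclic.path_unique (Nonempty.some (hT.isConnected.preconnected u r)).toPath ⟨q, hq⟩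
      simp [this, h]
    · rw [wdist_eq T hT E w r v _ hp.reverse, wdist_eq T hT E w r u _ hq.reverse]
      rw [Sym2.eq_swap (a := v) (b := u)]
      simp [add_comm]

lemma sum_deg {n : ℕ} (T : SimpleGraph (Fin n))
    (E : Fin (n - 1) → Fin n × Fin n)
    (hE : ∀ i, T.Adj (E i).1 (E i).2)
    (hinj : Function.Injective fun i => (s((E i).1, (E i).2) : Sym2 (Fin n)))
    (hsurj : ∀ e ∈ T.edgeSet, ∃ i, e = s((E i).1, (E i).2)) (v : Fin n) :
    (degr T v : ℝ) = ∑ i, ((if (E i).1 = v then 1 else 0) + (if (E i).2 = v then 1 else 0) : ℝ) := by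
  have h1 : ∀ i, ((if (E i).1 = v then 1 else 0) + (if (E i).2 = v then 1 else 0) : ℝ) =
      if (E i).1 = v ∨ (E i).2 = v then 1 else 0 := by
    intro i
    have := (hE i).ne
    by_cases h : (E i).1 = v <;> by_cases h' : (E i).2 = v <;> simp_all
  simp_rw [h1]
  rw [Finset.sum_boole]
  congr 1
  unfold degr
  symm
  rw [← Set.ncard_coe_finset]
  refine Set.ncard_congr (fun i _ => if (E i).1 = v then (E i).2 else (E i).1) ?_ ?_ ?_
  · intro i hi
    have := hE i
    have := (hE i).symm
    simp at hi ⊢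
    split_ifs <;> grind
  · intro i j hi hj hij
    apply hinj
    simp at hi hj ⊢
    grind
  · intro u hu
    obtain ⟨i, hi⟩ := hsurj s(v,u) hu
    have := T.ne_of_adj hu
    refine ⟨i, ?_, ?_⟩
    · simp at hi ⊢; grind
    · simp at hi ⊢; grind

theorem stmt4 {n : ℕ} (T : SimpleGraph (Fin n)) (hT : T.IsTree)
    (E : Fin (n - 1) → Fin n × Fin n) (w : Fin (n - 1) → ℝ)
    (hw : ∀ i, w i ≠ 0)
    (hE : ∀ i, T.Adj (E i).1 (E i).2)
    (hinj : Function.Injective fun i => (s((E i).1, (E i).2) : Sym2 (Fin n)))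
    (hsurj : ∀ e ∈ T.edgeSet, ∃ i, e = s((E i).1, (E i).2)) :
    distMat T hT.isConnected E w *ᵥ (fun v => 2 - (degr T v : ℝ)) = fun _ => ∑ i, w i := by
  classical
  funext r
  obtain ⟨L, hL⟩ := parent_exists T hT E w r
  choose! P hP using hL
  set f : Fin n → ℝ := fun v => wdist T hT.isConnected E w r v with hf
  have hr : f r = 0 := by
    rw [hf]; simp only
    rw [wdist_eq T hT E w r r .nil (by simp)]; simp
  have key : ∀ i, ∀ v, s(v, P v) = s((E i).1, (E i).2) → v ≠ r →
      f (E i).1 + f (E i).2 = 2 * f v - w i := by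
    intro i v h hv
    have h2 := (hP v hv).2.2
    have h3 : (∑ j : Fin (n-1), if s(v,P v) = s((E j).1, (E j).2) then w j else 0) = w i := by
      rw [Finset.sum_eq_single i]
      · simp [h]
      · intro j _ hj
        rw [if_neg]
        intro h'
        exact hj (hinj (h'.symm.trans h))
      · simp
    rw [h3] at h2
    change f v = f (P v) + w i at h2
    rcases Sym2.eq_iff.1 h with ⟨a, b⟩ | ⟨a, b⟩ <;> rw [← a, ← b, h2] <;> ring
  have hg : ∀ v : {v : Fin n // v ≠ r}, ∃ i, s(v.1, P v.1) = s((E i).1, (E i).2) :=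
    fun v => hsurj s(v.1, P v.1) (hP v.1 v.2).1
  choose g hg using hg
  have ginj : Function.Injective g := by
    rintro ⟨u, hu⟩ ⟨v, hv⟩ h
    have h1 := hg ⟨u, hu⟩
    rw [h, ← hg ⟨v, hv⟩] at h1
    have a := (hP u hu).2.1
    have b := (hP v hv).2.1
    simp only at h1
    rcases Sym2.eq_iff.1 h1 with ⟨c, d⟩ | ⟨c, d⟩
    · exact Subtype.ext c
    · rw [d] at a; rw [← c] at b; omega
  have gbij : Function.Bijective g := by
    rw [Fintype.bijective_iff_injective_and_card]
    refine ⟨ginj, ?_⟩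
    simp [Fintype.card_subtype_compl]
  have e1 : ∑ i, (f (E i).1 + f (E i).2 + w i) = ∑ v, 2 * f v := by
    rw [← (Equiv.ofBijective g gbij).sum_comp]
    have : ∑ v, 2 * f v = ∑ v : {v : Fin n // v ≠ r}, 2 * f v.1 := by
      rw [← Finset.sum_subtype (Finset.univ.erase r) (by simp) (fun v => 2 * f v)]
      rw [Finset.sum_erase]; simp [hr]
    rw [this]
    refine Finset.sum_congr rfl fun v _ => ?_
    have := key _ _ (hg v) v.2
    simp only [Equiv.ofBijective_apply]
    linarith
  have e2 : ∑ v, f v * (degr T v : ℝ) = ∑ i, (f (E i).1 + f (E i).2) := by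
    simp_rw [sum_deg T E hE hinj hsurj, Finset.mul_sum]
    rw [Finset.sum_comm]
    refine Finset.sum_congr rfl fun i _ => ?_
    simp [mul_add, Finset.sum_add_distrib]
  change ∑ v, f v * (2 - (degr T v : ℝ)) = _
  simp_rw [mul_sub, Finset.sum_sub_distrib]
  rw [e2]
  rw [Finset.sum_add_distrib] at e1
  simp_rw [mul_comm _ (2:ℝ)]
  linarith

end
end

section
/- Let T be a tree with vertex set {1,...,n} whose edges are assigned nonzero real weights, let D and Δ be the weighted distance matrix and the squared distance matrix of T, let τ be the vector with components τ_i = 2 - δ_i (δ_i the degree of vertex i), and let δ̂ be the vector of weighted degrees, δ̂_i = sum of the weights of the edges incident to vertex i. Then Δ τ = D δ̂. -/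
open Finset Matrix

noncomputable section

theorem aux_wdist_path {n : ℕ} (T : SimpleGraph (Fin n)) (hT : T.IsTree)
    (E : Fin (n-1) → Fin n × Fin n) (w : Fin (n-1) → ℝ) (u v : Fin n)
    (p : T.Walk u v) (hp : p.IsPath) :
    wdist T hT.isConnected E w u v = (p.edges.map
    (fun s => ∑ i : Fin (n-1), if s = s((E i).1, (E i).2) then w i else 0)).sum := by
  unfold wdist
  have := hT.isAcyclic.path_unique
    ((Nonempty.some (hT.isConnected.preconnected u v)).toPath) ⟨p, hp⟩
  rw [this]

theorem aux_concat {n : ℕ} (T : SimpleGraph (Fin n)) (hT : T.IsTree)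
    (E : Fin (n-1) → Fin n × Fin n) (w : Fin (n-1) → ℝ)
    (hinj : Function.Injective fun i => (s((E i).1, (E i).2) : Sym2 (Fin n)))
    (u a b : Fin n) (k : Fin (n-1)) (hk : s(a, b) = s((E k).1, (E k).2))
    (p : T.Walk u a) (h : T.Adj a b) (hp : p.IsPath) (hq : (p.concat h).IsPath) :
    wdist T hT.isConnected E w u b = wdist T hT.isConnected E w u a + w k := by
  rw [aux_wdist_path T hT E w u b _ hq, aux_wdist_path T hT E w u a _ hp]
  rw [SimpleGraph.Walk.edges_concat]
  simp only [List.concat_eq_append, List.map_append, List.sum_append, List.map_cons,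
    List.map_nil, List.sum_cons, List.sum_nil, add_zero]
  congr 1
  rw [Finset.sum_eq_single k]
  · simp [hk]
  · intro j _ hj
    rw [if_neg]
    intro h'
    exact hj (hinj (h'.symm.trans hk))
  · simp

theorem aux_child {n : ℕ} (T : SimpleGraph (Fin n)) (hT : T.IsTree)
    (E : Fin (n-1) → Fin n × Fin n)
    (hE : ∀ i, T.Adj (E i).1 (E i).2) (u : Fin n) (k : Fin (n-1)) :
    ∃ a b : Fin n, (a = (E k).1 ∧ b = (E k).2 ∨ a = (E k).2 ∧ b = (E k).1) ∧
      ∃ (p : T.Walk u a) (h : T.Adj a b), p.IsPath ∧ (p.concat h).IsPath := by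
  obtain ⟨p, hp⟩ := hT.isConnected.exists_isPath u (E k).1
  obtain ⟨q, hq⟩ := hT.isConnected.exists_isPath u (E k).2
  by_cases hb : (E k).2 ∈ p.support
  · refine ⟨(E k).2, (E k).1, Or.inr ⟨rfl, rfl⟩, q, (hE k).symm, hq, ?_⟩
    rw [← hT.isAcyclic.path_concat hq hp (hE k).symm hb]
    exact hp
  · exact ⟨(E k).1, (E k).2, Or.inl ⟨rfl, rfl⟩, p, hE k, hp, hp.concat hb (hE k)⟩

theorem aux_degr {n : ℕ} (T : SimpleGraph (Fin n))
    (E : Fin (n - 1) → Fin n × Fin n)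
    (hE : ∀ i, T.Adj (E i).1 (E i).2)
    (hinj : Function.Injective fun i => (s((E i).1, (E i).2) : Sym2 (Fin n)))
    (hsurj : ∀ e ∈ T.edgeSet, ∃ i, e = s((E i).1, (E i).2)) (v : Fin n) :
    degr T v = (univ.filter (fun k => (E k).1 = v ∨ (E k).2 = v)).card := by
  classical
  have h1 : degr T v = (T.incidenceFinset v).card := by
    rw [SimpleGraph.card_incidenceFinset_eq_degree, ← SimpleGraph.card_neighborSet_eq_degree]
    unfold degr
    rw [← Nat.card_coe_set_eq, Nat.card_eq_fintype_card]
  rw [h1]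
  symm
  apply Finset.card_bij (fun k _ => s((E k).1, (E k).2))
  · intro k hk
    simp only [mem_filter, mem_univ, true_and] at hk
    rw [SimpleGraph.mem_incidenceFinset]
    refine ⟨hE k, ?_⟩
    rw [Sym2.mem_iff]
    exact hk.imp Eq.symm Eq.symm
  · intro i _ j _ h
    exact hinj h
  · intro e he
    rw [SimpleGraph.mem_incidenceFinset] at he
    obtain ⟨k, rfl⟩ := hsurj e he.1
    refine ⟨k, ?_, rfl⟩
    have := Sym2.mem_iff.1 he.2
    simp only [mem_filter, mem_univ, true_and]
    exact this.imp Eq.symm Eq.symm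

theorem aux_sum {n : ℕ} (T : SimpleGraph (Fin n))
    (E : Fin (n - 1) → Fin n × Fin n)
    (hE : ∀ i, T.Adj (E i).1 (E i).2) (g : Fin n → ℝ) (w : Fin (n-1) → ℝ) :
    ∑ v, g v * ∑ k ∈ univ.filter (fun k => (E k).1 = v ∨ (E k).2 = v), w k
      = ∑ k, w k * (g (E k).1 + g (E k).2) := by
  simp_rw [Finset.mul_sum, Finset.sum_filter]
  rw [Finset.sum_comm]
  refine Finset.sum_congr rfl fun k _ => ?_
  have hne := (hE k).ne
  have : ∀ v, (if (E k).1 = v ∨ (E k).2 = v then g v * w k else 0)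
      = (if (E k).1 = v then g v * w k else 0) + (if (E k).2 = v then g v * w k else 0) := by
    intro v
    by_cases h1 : (E k).1 = v
    · have h2 : (E k).2 ≠ v := fun h => hne (h1.trans h.symm)
      simp [h1, h2]
    · simp [h1]
  simp_rw [this, Finset.sum_add_distrib]
  simp
  ring

theorem stmt5 {n : ℕ} (T : SimpleGraph (Fin n)) (hT : T.IsTree)
    (E : Fin (n - 1) → Fin n × Fin n) (w : Fin (n - 1) → ℝ)
    (hw : ∀ i, w i ≠ 0)
    (hE : ∀ i, T.Adj (E i).1 (E i).2)
    (hinj : Function.Injective fun i => (s((E i).1, (E i).2) : Sym2 (Fin n)))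
    (hsurj : ∀ e ∈ T.edgeSet, ∃ i, e = s((E i).1, (E i).2)) :
    sqDistMat T hT.isConnected E w *ᵥ (fun v => 2 - (degr T v : ℝ))
      = distMat T hT.isConnected E w *ᵥ wdeg E w := by
  classical
  ext u
  simp only [sqDistMat, distMat, Matrix.mulVec, dotProduct, Matrix.of_apply]
  unfold wdeg
  rw [aux_sum T E hE]
  simp_rw [aux_degr T E hE hinj hsurj]
  set f := wdist T hT.isConnected E w u with hf
  have hdeg := aux_sum T E hE (fun v => f v ^ 2) (fun _ => 1)
  simp only [Finset.sum_const, nsmul_eq_mul, mul_one, one_mul] at hdeg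
  simp_rw [mul_sub, Finset.sum_sub_distrib]
  rw [hdeg]
  choose a b hab p h hp hq using aux_child T hT E hE u
  have hs : ∀ k, s(a k, b k) = s((E k).1, (E k).2) := by
    intro k
    rcases hab k with ⟨h1, h2⟩ | ⟨h1, h2⟩
    · rw [h1, h2]
    · rw [h1, h2, Sym2.eq_swap]
  have hfb : ∀ k, f (b k) = f (a k) + w k := fun k =>
    aux_concat T hT E w hinj u (a k) (b k) k (hs k) (p k) (h k) (hp k) (hq k)
  have hbu : ∀ k, b k ≠ u := by
    intro k hk
    have h1 := (SimpleGraph.Walk.concat_isPath_iff (h k)).1 (hq k)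
    exact h1.2 (hk ▸ (p k).start_mem_support)
  have hfu : f u = 0 := by
    rw [hf, aux_wdist_path T hT E w u u .nil .nil]
    simp
  have hpen : ∀ k (v : Fin n) (q : T.Walk u v), q.IsPath → b k = v → a k = q.penultimate := by
    rintro k v q hq' rfl
    have := hT.isAcyclic.path_unique ⟨q, hq'⟩ ⟨_, hq k⟩
    have h2 : q = (p k).concat (h k) := congrArg Subtype.val this
    rw [h2]
    simp
  have hbinj : Function.Injective b := by
    intro i j hij
    apply hinj
    show s((E i).1, (E i).2) = s((E j).1, (E j).2)
    have ha : a i = a j := (hpen i _ _ (hq j) hij).trans (hpen j _ _ (hq j) rfl).symm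
    rw [← hs, ← hs, hij, ha]
  have himg : univ.image b = univ.erase u := by
    apply Finset.eq_of_subset_of_card_le
    · intro v hv
      obtain ⟨k, -, rfl⟩ := Finset.mem_image.1 hv
      simp [hbu k]
    · rw [Finset.card_image_of_injective _ hbinj]
      simp
  have hsum : ∑ v, f v ^ 2 * 2 = ∑ k, f (b k) ^ 2 * 2 := by
    rw [← Finset.add_sum_erase _ _ (mem_univ u), ← himg,
      Finset.sum_image (fun i _ j _ hij => hbinj hij), hfu]
    simp
  rw [hsum, ← Finset.sum_sub_distrib]
  refine Finset.sum_congr rfl fun k _ => ?_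
  have := hfb k
  rcases hab k with ⟨h1, h2⟩ | ⟨h1, h2⟩
  · rw [← h1, ← h2, this]; ring
  · rw [← h1, ← h2, this]; ring

end
end

section
/- Let T be a tree on n vertices with an orientation assigned to each edge, and let H be the (n-1)×(n-1) edge orientation matrix of T. Then det H = 2^{n-2} ∏_{i=1}^n τ_i, where τ_i = 2 - δ_i and δ_i is the degree of vertex i. -/
open Finset Matrix

noncomputable section

section LinAlg

variable {ι V : Type*} [Fintype ι] [DecidableEq ι] [Fintype V] [DecidableEq V]

lemma aux_sum_s6 {R : Type*} [Ring R] (r : V) (c : ι → V) (hc : Function.Injective c)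
    (hcr : ∀ i, c i ≠ r) (hcs : ∀ v, v ≠ r → ∃ i, c i = v) (x : V) (g : V → R) :
    ∑ k, (if x = c k then g (c k) else 0) = if x = r then 0 else g x := by
  split_ifs with h
  · apply Finset.sum_eq_zero
    intro k _
    rw [if_neg]
    rw [h]
    exact (hcr k).symm
  · obtain ⟨i, rfl⟩ := hcs x h
    simp [hc.eq_iff]

lemma aux_det_sq (A B : Matrix ι ι ℤ) (h : B * A = 1) : B.det ^ 2 = 1 := by
  have h1 : B.det * A.det = 1 := by rw [← Matrix.det_mul, h, Matrix.det_one]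
  rcases Int.isUnit_iff.1 (IsUnit.of_mul_eq_one _ h1) with h | h <;> simp [h]

lemma aux_linalg (r : V) (c p : ι → V) (hc : Function.Injective c)
    (hcr : ∀ i, c i ≠ r) (hcs : ∀ v, v ≠ r → ∃ i, c i = v)
    (a : V → ι → Prop) [∀ v j, Decidable (a v j)] (har : ∀ j, ¬ a r j)
    (hstep : ∀ i j, i ≠ j → (a (c i) j ↔ a (p i) j))
    (hci : ∀ i, a (c i) i) (hpi : ∀ i, ¬ a (p i) i)
    (G : Matrix ι ι ℝ)
    (hG : ∀ i j, G i j = 2 * ((if a (c i) j then 1 else 0) + (if a (c j) i then 1 else 0)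
      - (if i = j then 1 else 0)) - 1) :
    G.det = 2 ^ (Fintype.card ι) *
      ∏ v, (1 - (if v = r then (1/2 : ℝ) else 1) * (#{i | p i = v} : ℝ)) := by
  set P : Matrix ι ι ℤ := Matrix.of fun i j => if p i = c j then 1 else 0 with hP
  set A : Matrix ι ι ℤ := Matrix.of fun i j => if a (c i) j then 1 else 0 with hA
  have hBA : (1 - P) * A = 1 := by
    ext i j
    rw [sub_mul, one_mul, Matrix.sub_apply, Matrix.mul_apply, Matrix.one_apply]
    have := aux_sum_s6 r c hc hcr hcs (p i) (fun v => if a v j then (1:ℤ) else 0)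
    simp only [hP, hA, Matrix.of_apply, ite_mul, one_mul, zero_mul]
    rw [this]
    have e1 : (if p i = r then (0:ℤ) else if a (p i) j then 1 else 0)
        = if a (p i) j then 1 else 0 := by
      by_cases h : p i = r
      · simp [h, har]
      · simp [h]
    rw [e1]
    by_cases hij : i = j
    · subst hij; simp [hci, hpi]
    · simp [hij, hstep i j hij]
  have hdet := aux_det_sq A (1 - P) hBA
  set P' : Matrix ι ι ℝ := P.map (Int.castRingHom ℝ) with hP'
  set A' : Matrix ι ι ℝ := A.map (Int.castRingHom ℝ) with hA'
  have hB' : (1 - P') = (1 - P).map (Int.castRingHom ℝ) := by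
    ext i j
    by_cases h : i = j <;> simp [hP', Matrix.one_apply, h]
  have hBA' : (1 - P') * A' = 1 := by
    rw [hB', hA', ← Matrix.map_mul, hBA]
    simp
  have hdet' : (1 - P').det ^ 2 = 1 := by
    rw [hB', ← RingHom.mapMatrix_apply, ← RingHom.map_det, ← map_pow, hdet, map_one]
  have hP'a : ∀ i j, P' i j = if p i = c j then 1 else 0 := by
    intro i j; simp [hP', hP]
  have hA'a : ∀ i j, A' i j = if a (c i) j then 1 else 0 := by
    intro i j; simp [hA', hA]
  set b : ι → ℝ := fun _ => 1 with hb
  have hGm : G = (2:ℝ) • (A' + A'ᵀ - 1) - Matrix.vecMulVec b b := by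
    ext i j
    simp [hG, hA'a, Matrix.one_apply, Matrix.vecMulVec_apply, hb]
  have hAB : A'ᵀ * (1 - P')ᵀ = 1 := by
    rw [← Matrix.transpose_mul, hBA', Matrix.transpose_one]
  set R : Matrix ι V ℝ := Matrix.of fun i v => if p i = v then 1 else 0 with hR
  set w : V → ℝ := fun v => if v = r then (1/2 : ℝ) else 1 with hw
  have hbv : (1 - P') *ᵥ b = fun i => if p i = r then 1 else 0 := by
    ext i
    have := aux_sum_s6 r c hc hcr hcs (p i) (fun v => (1:ℝ))
    rw [Matrix.sub_mulVec, Matrix.one_mulVec]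
    simp only [Pi.sub_apply, Matrix.mulVec, dotProduct, hP'a, hb, mul_one]
    rw [this]
    split_ifs <;> simp
  have hPP : ∀ i j, (P' * P'ᵀ) i j = if p i = r then 0 else if p j = p i then 1 else 0 := by
    intro i j
    have := aux_sum_s6 r c hc hcr hcs (p i) (fun v => if p j = v then (1:ℝ) else 0)
    rw [← this]
    rw [Matrix.mul_apply]
    apply Finset.sum_congr rfl
    intro k _
    rw [Matrix.transpose_apply, hP'a, hP'a, ite_mul, one_mul, zero_mul]
  have key : (1 - P') * G * (1 - P')ᵀ = (2:ℝ) • (1 - R * (Matrix.diagonal w * Rᵀ)) := by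
    have e1 : (1 - P') * (A' + A'ᵀ - 1) * (1 - P')ᵀ = 1 - P' * P'ᵀ := by
      have : (1 - P') * (A' + A'ᵀ - 1) * (1 - P')ᵀ =
          ((1 - P') * A') * (1 - P')ᵀ + (1 - P') * (A'ᵀ * (1 - P')ᵀ)
            - (1 - P') * (1 - P')ᵀ := by noncomm_ring
      rw [this, hBA', hAB, Matrix.transpose_sub, Matrix.transpose_one]
      noncomm_ring
    have e2 : (1 - P') * Matrix.vecMulVec b b * (1 - P')ᵀ =
        Matrix.vecMulVec ((1 - P') *ᵥ b) ((1 - P') *ᵥ b) := by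
      rw [Matrix.mul_vecMulVec, Matrix.vecMulVec_mul, Matrix.vecMul_transpose]
    rw [hGm, mul_sub, sub_mul, Matrix.mul_smul, Matrix.smul_mul, e1, e2, hbv]
    ext i j
    have e3 : (R * (Matrix.diagonal w * Rᵀ)) i j = if p j = p i then w (p i) else 0 := by
      rw [Matrix.mul_apply]
      simp only [Matrix.diagonal_mul, Matrix.transpose_apply, hR, Matrix.of_apply, ite_mul,
        one_mul, zero_mul, Finset.sum_ite_eq, Finset.mem_univ, if_true, mul_ite, mul_one,
        mul_zero]
      by_cases h0 : p i = p j
      · simp [h0]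
      · rw [if_neg h0, if_neg (Ne.symm h0)]
    rw [Matrix.sub_apply, Matrix.smul_apply, Matrix.smul_apply, Matrix.sub_apply,
      Matrix.sub_apply, e3, hPP, Matrix.vecMulVec_apply]
    by_cases h1 : p i = r
    · by_cases h2 : p j = r
      · simp [h1, h2, hw]; ring
      · simp [h1, h2, hw]
    · by_cases h2 : p j = p i
      · simp [h1, h2, hw]
      · simp [h1, h2]
  have hd := congrArg Matrix.det key
  rw [Matrix.det_mul, Matrix.det_mul, Matrix.det_transpose, Matrix.det_smul,
    Matrix.det_one_sub_mul_comm] at hd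
  have hRR : Rᵀ * R = Matrix.diagonal fun v => (#{i | p i = v} : ℝ) := by
    ext u v
    rw [Matrix.mul_apply, Matrix.diagonal_apply]
    by_cases h : u = v
    · subst h
      rw [if_pos rfl, Finset.card_filter, Nat.cast_sum]
      apply Finset.sum_congr rfl
      intro i _
      by_cases h3 : p i = u <;> simp [hR, h3]
    · rw [if_neg h]
      apply Finset.sum_eq_zero
      intro i _
      simp only [hR, Matrix.transpose_apply, Matrix.of_apply]
      by_cases h3 : p i = u
      · have : p i ≠ v := fun h4 => h (h3.symm.trans h4)
        simp [this]
      · simp [h3]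
  rw [Matrix.mul_assoc, hRR, Matrix.diagonal_mul_diagonal,
    ← Matrix.diagonal_one (n := V), Matrix.diagonal_sub, Matrix.det_diagonal] at hd
  rw [← hd]
  linear_combination (- G.det) * hdet'

end LinAlg

section Graph

variable {V : Type*} {T : SimpleGraph V}

lemma aux_unique (hT : T.IsTree) {y u w₁ w₂ : V} (h1 : T.Adj u w₁) (h2 : T.Adj u w₂)
    (d1 : T.dist y u = T.dist y w₁ + 1) (d2 : T.dist y u = T.dist y w₂ + 1) : w₁ = w₂ := by
  obtain ⟨q₁, hq₁⟩ := hT.connected.exists_walk_length_eq_dist w₁ y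
  obtain ⟨q₂, hq₂⟩ := hT.connected.exists_walk_length_eq_dist w₂ y
  have e1 := (SimpleGraph.Walk.cons h1 q₁).isPath_of_length_eq_dist (by
    rw [SimpleGraph.Walk.length_cons, hq₁, SimpleGraph.dist_comm, ← d1, SimpleGraph.dist_comm])
  have e2 := (SimpleGraph.Walk.cons h2 q₂).isPath_of_length_eq_dist (by
    rw [SimpleGraph.Walk.length_cons, hq₂, SimpleGraph.dist_comm, ← d2, SimpleGraph.dist_comm])
  have := (hT.existsUnique_path u y).unique e1 e2
  simp only [SimpleGraph.Walk.cons.injEq] at this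
  exact this.1

lemma aux_exists (hT : T.IsTree) {y u : V} (h : u ≠ y) :
    ∃ w, T.Adj u w ∧ T.dist y u = T.dist y w + 1 := by
  obtain ⟨q, hq⟩ := hT.connected.exists_walk_length_eq_dist u y
  cases q with
  | nil => exact absurd rfl h
  | @cons _ w _ hw q =>
    refine ⟨w, hw, ?_⟩
    have h1 := SimpleGraph.dist_le q
    rw [SimpleGraph.Walk.length_cons] at hq
    have h2 := hT.dist_eq_dist_add_one_of_adj y hw
    rw [SimpleGraph.dist_comm] at hq h1
    omega

lemma aux_cut (hT : T.IsTree) {x y u v : V} (hxy : T.Adj x y) (huv : T.Adj u v)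
    (h1 : T.dist u x < T.dist u y) (h2 : T.dist v y < T.dist v x) : u = x ∧ v = y := by
  have a1 := hT.dist_eq_dist_add_one_of_adj u hxy
  have a2 := hT.dist_eq_dist_add_one_of_adj v hxy
  have a3 := hT.dist_eq_dist_add_one_of_adj x huv
  have a4 := hT.dist_eq_dist_add_one_of_adj y huv
  have c1 := T.dist_comm (u := u) (v := x)
  have c2 := T.dist_comm (u := u) (v := y)
  have c3 := T.dist_comm (u := v) (v := x)
  have c4 := T.dist_comm (u := v) (v := y)
  by_cases hux : u = x
  · refine ⟨hux, ?_⟩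
    subst hux
    have : T.dist u u = 0 := T.dist_self
    exact (hT.connected.dist_eq_zero_iff).1 (by omega)
  · exfalso
    obtain ⟨w, hw, hd⟩ := aux_exists hT hux
    have a5 := hT.dist_eq_dist_add_one_of_adj w hxy
    have a6 := hT.dist_eq_dist_add_one_of_adj y hw
    have c5 := T.dist_comm (u := w) (v := x)
    have c6 := T.dist_comm (u := w) (v := y)
    have : w = v := aux_unique hT (y := y) hw huv (by omega) (by omega)
    subst this
    omega

end Graph

theorem stmt6 {n : ℕ} (T : SimpleGraph (Fin n)) (hT : T.IsTree)
    (E : Fin (n - 1) → Fin n × Fin n)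
    (hE : ∀ i, T.Adj (E i).1 (E i).2)
    (hinj : Function.Injective fun i => (s((E i).1, (E i).2) : Sym2 (Fin n)))
    (hsurj : ∀ e ∈ T.edgeSet, ∃ i, e = s((E i).1, (E i).2)) :
    (orientMat T E).det = (2 : ℝ) ^ ((n : ℤ) - 2) * ∏ v, (2 - (degr T v : ℝ)) := by
  classical
  obtain ⟨r⟩ := hT.connected.nonempty
  have hn : 1 ≤ n := by have := r.2; omega
  have hex : ∀ i, ∃ q : Fin n × Fin n × ℝ,
      T.dist r q.1 = T.dist r q.2.1 + 1 ∧
      ((E i = (q.1, q.2.1) ∧ q.2.2 = 1) ∨ (E i = (q.2.1, q.1) ∧ q.2.2 = -1)) := by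
    intro i
    rcases hT.dist_eq_dist_add_one_of_adj r (hE i) with h | h
    · exact ⟨((E i).1, (E i).2, 1), h, Or.inl ⟨rfl, rfl⟩⟩
    · exact ⟨((E i).2, (E i).1, -1), h, Or.inr ⟨rfl, rfl⟩⟩
  choose q hq1 hq2 using hex
  set c : Fin (n-1) → Fin n := fun i => (q i).1 with hcdef
  set p : Fin (n-1) → Fin n := fun i => (q i).2.1 with hpdef
  set σ : Fin (n-1) → ℝ := fun i => (q i).2.2 with hσdef
  have hd : ∀ i, T.dist r (c i) = T.dist r (p i) + 1 := hq1
  have ho : ∀ i, (E i = (c i, p i) ∧ σ i = 1) ∨ (E i = (p i, c i) ∧ σ i = -1) := hq2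
  have hs : ∀ i, (s((E i).1, (E i).2) : Sym2 (Fin n)) = s(c i, p i) := by
    intro i
    rcases ho i with ⟨h, _⟩ | ⟨h, _⟩
    · rw [h]
    · rw [h]; exact Sym2.eq_swap
  clear_value c p σ
  clear hq1 hq2
  have hadj : ∀ i, T.Adj (c i) (p i) := by
    intro i
    have := hE i
    rw [← SimpleGraph.mem_edgeSet, hs, SimpleGraph.mem_edgeSet] at this
    exact this
  have hinj' : ∀ i j, c i = c j → p i = p j → i = j := by
    intro i j h1 h2
    apply hinj
    simp only [hs, h1, h2]
  have hc : Function.Injective c := by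
    intro i j h
    refine hinj' i j h ?_
    have := hadj j
    have h2 := hd j
    rw [← h] at this h2
    exact aux_unique hT (hadj i) this (hd i) h2
  have hcr : ∀ i, c i ≠ r := by
    intro i h
    have := hd i
    rw [h, SimpleGraph.dist_self] at this
    omega
  have hedge : ∀ x y, T.Adj x y → T.dist r x = T.dist r y + 1 → ∃ i, c i = x ∧ p i = y := by
    intro x y hxy hdxy
    obtain ⟨i, hi⟩ := hsurj s(x, y) hxy
    rw [hs, Sym2.eq_iff] at hi
    refine ⟨i, ?_⟩
    rcases hi with ⟨h1, h2⟩ | ⟨h1, h2⟩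
    · exact ⟨h1.symm, h2.symm⟩
    · have := hd i
      rw [← h1, ← h2] at this
      omega
  have hcs : ∀ v, v ≠ r → ∃ i, c i = v := by
    intro v hv
    obtain ⟨w, hw, hdw⟩ := aux_exists hT hv
    obtain ⟨i, hi, _⟩ := hedge v w hw hdw
    exact ⟨i, hi⟩
  set a : Fin n → Fin (n-1) → Prop := fun z j => T.dist z (c j) < T.dist z (p j) with ha
  have hdich : ∀ z j, T.dist z (c j) = T.dist z (p j) + 1 ∨
      T.dist z (p j) = T.dist z (c j) + 1 := fun z j => hT.dist_eq_dist_add_one_of_adj z (hadj j)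
  have har : ∀ j, ¬ a r j := by
    intro j; simp only [ha]; have := hd j; omega
  have hstep : ∀ i j, i ≠ j → (a (c i) j ↔ a (p i) j) := by
    intro i j hij
    simp only [ha]
    constructor
    · intro h
      by_contra h'
      have h3 := hdich (p i) j
      obtain ⟨e1, e2⟩ := aux_cut hT (hadj j) (hadj i) h (by omega)
      exact hij (hinj' i j e1 e2)
    · intro h
      by_contra h'
      have h3 := hdich (c i) j
      obtain ⟨e1, e2⟩ := aux_cut hT (hadj j) (hadj i).symm h (by omega)
      have h4 := hd i
      have h5 := hd j
      rw [e1, e2] at h4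
      omega
  have hci : ∀ i, a (c i) i := by
    intro i
    simp only [ha]
    rw [SimpleGraph.dist_self, SimpleGraph.dist_eq_one_iff_adj.2 (hadj i)]
    exact one_pos
  have hpi : ∀ i, ¬ a (p i) i := by
    intro i
    simp only [ha]
    rw [SimpleGraph.dist_self]
    exact Nat.not_lt_zero _
  have hdepth : ∀ k z j, T.dist r z = k → a z j → T.dist r (c j) ≤ T.dist r z := by
    intro k
    induction k with
    | zero =>
      intro z j hz haz
      rw [hT.connected.dist_eq_zero_iff] at hz
      subst hz
      exact absurd haz (har j)
    | succ k ih =>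
      intro z j hz haz
      have hzr : z ≠ r := by
        rintro rfl
        rw [SimpleGraph.dist_self] at hz
        omega
      obtain ⟨i, rfl⟩ := hcs z hzr
      by_cases hij : i = j
      · rw [hij]
      · have h1 := ih (p i) j (by have := hd i; omega) ((hstep i j hij).1 haz)
        have := hd i
        omega
  have hanti : ∀ i j, i ≠ j → a (c i) j → a (c j) i → False := by
    intro i j hij h1 h2
    have e1 := hdepth _ _ j rfl ((hstep i j hij).1 h1)
    have e2 := hdepth _ _ i rfl ((hstep j i hij.symm).1 h2)
    have := hd i
    have := hd j
    omega
  have hσ : ∀ i, σ i * σ i = 1 := by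
    intro i
    rcases ho i with ⟨_, h⟩ | ⟨_, h⟩ <;> rw [h] <;> norm_num
  set G : Matrix (Fin (n-1)) (Fin (n-1)) ℝ :=
    Matrix.of fun i j => σ i * (σ j * orientMat T E i j) with hGdef
  have hdetG : G.det = (orientMat T E).det := by
    have e1 : G = Matrix.of fun i j => σ i * (Matrix.of fun i j => σ j * orientMat T E i j) i j := rfl
    rw [e1, Matrix.det_mul_column, Matrix.det_mul_row, ← mul_assoc, ← Finset.prod_mul_distrib]
    simp [hσ]
  have hG : ∀ i j, G i j = 2 * ((if a (c i) j then 1 else 0) + (if a (c j) i then 1 else 0)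
      - (if i = j then 1 else 0)) - 1 := by
    intro i j
    simp only [hGdef, Matrix.of_apply, orientMat]
    by_cases hij : i = j
    · subst hij
      rw [← mul_assoc, hσ]
      simp only [hci, SimpleGraph.dist_self, if_true]
      norm_num
    · have s1 := hstep i j hij
      have s2 := hstep j i (Ne.symm hij)
      have s3 := hanti i j hij
      simp only [ha] at s1 s2 s3 ⊢
      have d1 := hdich (c i) j
      have d2 := hdich (p i) j
      have d3 := hdich (c j) i
      have d4 := hdich (p j) i
      have c1 := T.dist_comm (u := c i) (v := c j)
      have c2 := T.dist_comm (u := c i) (v := p j)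
      have c3 := T.dist_comm (u := p i) (v := c j)
      have c4 := T.dist_comm (u := p i) (v := p j)
      rw [if_neg hij]
      by_cases b1 : T.dist (c i) (c j) < T.dist (c i) (p j)
      · have b2 : ¬ T.dist (c j) (c i) < T.dist (c j) (p i) := fun b2 => s3 b1 b2
        have b3 := s1.1 b1
        have b4 := fun h => b2 (s2.2 h)
        rw [if_pos b1, if_neg b2]
        rcases ho i with ⟨h1, h2⟩ | ⟨h1, h2⟩ <;> rcases ho j with ⟨h3, h4⟩ | ⟨h3, h4⟩ <;>
          simp only [h1, h2, h3, h4]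
        · rw [if_pos (by omega)]; norm_num
        · rw [if_neg (by omega)]; norm_num
        · rw [if_neg (by omega)]; norm_num
        · rw [if_pos (by omega)]; norm_num
      · have b3 := fun h => b1 (s1.2 h)
        by_cases b2 : T.dist (c j) (c i) < T.dist (c j) (p i)
        · have b4 := s2.1 b2
          rw [if_neg b1, if_pos b2]
          rcases ho i with ⟨h1, h2⟩ | ⟨h1, h2⟩ <;> rcases ho j with ⟨h3, h4⟩ | ⟨h3, h4⟩ <;>
            simp only [h1, h2, h3, h4]
          · rw [if_pos (by omega)]; norm_num
          · rw [if_neg (by omega)]; norm_num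
          · rw [if_neg (by omega)]; norm_num
          · rw [if_pos (by omega)]; norm_num
        · have b4 := fun h => b2 (s2.2 h)
          rw [if_neg b1, if_neg b2]
          rcases ho i with ⟨h1, h2⟩ | ⟨h1, h2⟩ <;> rcases ho j with ⟨h3, h4⟩ | ⟨h3, h4⟩ <;>
            simp only [h1, h2, h3, h4]
          · rw [if_neg (by omega)]; norm_num
          · rw [if_pos (by omega)]; norm_num
          · rw [if_pos (by omega)]; norm_num
          · rw [if_neg (by omega)]; norm_num
  have hmain := aux_linalg r c p hc hcr hcs a har hstep hci hpi G hG
  have hdeg : ∀ v, degr T v = #{i | p i = v} + if v = r then 0 else 1 := by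
    intro v
    have hset : T.neighborSet v =
        (((Finset.univ.filter fun i => p i = v).image c ∪
          (Finset.univ.filter fun i => c i = v).image p : Finset (Fin n)) : Set (Fin n)) := by
      ext w
      simp only [SimpleGraph.mem_neighborSet, Finset.mem_coe, Finset.mem_union,
        Finset.mem_image, Finset.mem_filter, Finset.mem_univ, true_and]
      constructor
      · intro h
        rcases hT.dist_eq_dist_add_one_of_adj r h with h' | h'
        · obtain ⟨i, h1, h2⟩ := hedge v w h h'
          exact Or.inr ⟨i, h1, h2⟩
        · obtain ⟨i, h1, h2⟩ := hedge w v h.symm h'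
          exact Or.inl ⟨i, h2, h1⟩
      · rintro (⟨i, rfl, rfl⟩ | ⟨i, rfl, rfl⟩)
        · exact (hadj i).symm
        · exact hadj i
    have hdisj : Disjoint ((Finset.univ.filter fun i => p i = v).image c)
        ((Finset.univ.filter fun i => c i = v).image p) := by
      rw [Finset.disjoint_left]
      intro w h1 h2
      simp only [Finset.mem_image, Finset.mem_filter, Finset.mem_univ, true_and] at h1 h2
      obtain ⟨i, h3, h4⟩ := h1
      obtain ⟨j, h5, h6⟩ := h2
      have e1 := hd i
      have e2 := hd j
      rw [h3, h4] at e1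
      rw [h5, h6] at e2
      omega
    rw [degr, hset, Set.ncard_coe_finset, Finset.card_union_of_disjoint hdisj,
      Finset.card_image_of_injective _ hc]
    congr 1
    by_cases hv : v = r
    · subst hv
      have : (Finset.univ.filter fun i => c i = v) = ∅ := by
        ext i; simp [hcr i]
      rw [this]; simp
    · obtain ⟨i, rfl⟩ := hcs v hv
      have : (Finset.univ.filter fun j => c j = c i) = {i} := by
        ext j; simp [hc.eq_iff]
      rw [this]; simp [hv]
  rw [← hdetG, hmain, Fintype.card_fin, ← Finset.mul_prod_erase _ _ (Finset.mem_univ r),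
    ← Finset.mul_prod_erase univ (fun v => 2 - (degr T v : ℝ)) (Finset.mem_univ r)]
  have hprod : ∏ v ∈ univ.erase r, (1 - (if v = r then (1/2 : ℝ) else 1) * (#{i | p i = v} : ℝ))
      = ∏ v ∈ univ.erase r, (2 - (degr T v : ℝ)) := by
    apply Finset.prod_congr rfl
    intro v hv
    have hv' := Finset.ne_of_mem_erase hv
    rw [hdeg, if_neg hv', if_neg hv']
    push_cast
    ring
  rw [hprod, hdeg r, if_pos rfl, if_pos rfl]
  have hpow : (2:ℝ) ^ (n - 1) = 2 ^ ((n:ℤ) - 2) * 2 := by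
    rw [← zpow_natCast, ← zpow_add_one₀ (by norm_num)]
    congr 1
    omega
  rw [hpow]
  push_cast
  ring

end
end

section
/- Let T be a tree on n vertices having no vertex of degree 2, with an orientation assigned to each edge. Let H be the edge orientation matrix of T, Q the oriented vertex-edge incidence matrix (using the same orientation), and τ̂ the n×n diagonal matrix with diagonal entries 1/τ_1,...,1/τ_n, where τ_i = 2 - δ_i and δ_i is the degree of vertex i. Then H is nonsingular and H^{-1} = (1/2) Q' τ̂ Q. -/
open Finset Matrix

noncomputable section

theorem aux_parent {n : ℕ} {T : SimpleGraph (Fin n)} (hT : T.IsTree) {z v : Fin n} (h : v ≠ z) :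
    ∃ u, T.Adj v u ∧ T.dist z v = T.dist z u + 1 := by
  obtain ⟨p, hp⟩ := hT.connected.exists_walk_length_eq_dist v z
  cases p with
  | nil => exact absurd rfl h
  | @cons _ u _ hvu q =>
    refine ⟨u, hvu, ?_⟩
    have h1 := SimpleGraph.dist_le q
    have h2 := hT.dist_eq_dist_add_one_of_adj z hvu
    simp only [SimpleGraph.Walk.length_cons] at hp
    rw [SimpleGraph.dist_comm] at hp h1
    omega

theorem aux_parent_unique {n : ℕ} {T : SimpleGraph (Fin n)} (hT : T.IsTree) {z v u w : Fin n}
    (hu : T.Adj v u) (hw : T.Adj v w) (h1 : T.dist z v = T.dist z u + 1)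
    (h2 : T.dist z v = T.dist z w + 1) : u = w := by
  obtain ⟨p, hp⟩ := hT.connected.exists_walk_length_eq_dist u z
  obtain ⟨q, hq⟩ := hT.connected.exists_walk_length_eq_dist w z
  have hp' : (SimpleGraph.Walk.cons hu p).IsPath := by
    apply SimpleGraph.Walk.isPath_of_length_eq_dist
    rw [SimpleGraph.Walk.length_cons, hp, SimpleGraph.dist_comm, ← h1, SimpleGraph.dist_comm]
  have hq' : (SimpleGraph.Walk.cons hw q).IsPath := by
    apply SimpleGraph.Walk.isPath_of_length_eq_dist
    rw [SimpleGraph.Walk.length_cons, hq, SimpleGraph.dist_comm, ← h2, SimpleGraph.dist_comm]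
  have := (hT.existsUnique_path v z).unique hp' hq'
  have h3 := congrArg SimpleGraph.Walk.snd this
  simpa using h3

theorem aux_cross {n : ℕ} {T : SimpleGraph (Fin n)} (hT : T.IsTree) {p q r s : Fin n}
    (hpq : T.Adj p q) (hrs : T.Adj r s)
    (h1 : T.dist s p = T.dist r p + 1) (h2 : T.dist r q = T.dist s q + 1) : p = r ∧ q = s := by
  have a := hT.dist_eq_dist_add_one_of_adj r hpq
  have b := hT.dist_eq_dist_add_one_of_adj s hpq
  have hp : p = r := by
    by_contra hne
    obtain ⟨u, hu, hd⟩ := aux_parent hT hne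
    have c := hT.dist_eq_dist_add_one_of_adj u hrs
    rw [SimpleGraph.dist_comm (u := u), SimpleGraph.dist_comm (u := u)] at c
    have e := hT.dist_eq_dist_add_one_of_adj s hu
    have : q = u := aux_parent_unique hT hpq hu (z := s) (by omega) (by omega)
    subst this
    omega
  subst hp
  refine ⟨rfl, ?_⟩
  have : T.dist p p = 0 := by simp
  have h0 : T.dist s q = 0 := by omega
  exact ((hT.connected.dist_eq_zero_iff).1 h0).symm

open Classical in
theorem aux_degsum {n : ℕ} {T : SimpleGraph (Fin n)} (hT : T.IsTree) {z v : Fin n} (h : v ≠ z) :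
    ∑ u ∈ univ.filter (fun u => T.Adj v u), ((T.dist z u : ℝ) - T.dist z v)
      = (degr T v : ℝ) - 2 := by
  obtain ⟨w, hw, hd⟩ := aux_parent hT h
  have hcard : (degr T v : ℝ) = ∑ u ∈ univ.filter (fun u => T.Adj v u), (1 : ℝ) := by
    rw [Finset.sum_const, nsmul_eq_mul, mul_one, degr, ← Set.ncard_coe_finset]
    congr 2
    ext u; simp
  have h2 : (2 : ℝ) = ∑ u ∈ univ.filter (fun u => T.Adj v u), if u = w then (2 : ℝ) else 0 := by
    rw [Finset.sum_ite_eq']; simp [hw]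
  rw [hcard]
  conv_rhs => rw [h2]
  rw [← Finset.sum_sub_distrib]
  refine Finset.sum_congr rfl fun u hu => ?_
  have hu : T.Adj v u := by simpa using hu
  rcases hT.dist_eq_dist_add_one_of_adj z hu with h3 | h3
  · have := aux_parent_unique hT hu hw h3 hd
    rw [if_pos this, h3]; push_cast; ring
  · have : u ≠ w := by rintro rfl; omega
    rw [if_neg this, h3]; push_cast; ring

open Classical in
theorem aux_edgesum {n : ℕ} {T : SimpleGraph (Fin n)}
    (E : Fin (n - 1) → Fin n × Fin n)
    (hE : ∀ i, T.Adj (E i).1 (E i).2)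
    (hinj : Function.Injective fun i => (s((E i).1, (E i).2) : Sym2 (Fin n)))
    (hsurj : ∀ e ∈ T.edgeSet, ∃ i, e = s((E i).1, (E i).2)) (v : Fin n) (F : Fin n → ℝ) :
    ∑ i, (if (E i).1 = v then F (E i).2 else if (E i).2 = v then F (E i).1 else 0)
      = ∑ u ∈ univ.filter (fun u => T.Adj v u), F u := by
  have h1 : ∀ i, (if (E i).1 = v then F (E i).2 else if (E i).2 = v then F (E i).1 else 0)
      = ∑ u ∈ univ.filter (fun u => T.Adj v u),
        if s(v, u) = s((E i).1, (E i).2) then F u else 0 := by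
    intro i
    have hi := hE i
    split_ifs with h h'
    · subst h
      rw [Finset.sum_eq_single (E i).2]
      · simp
      · intro b _ hb
        rw [if_neg]
        intro hh
        rw [Sym2.congr_right] at hh
        exact hb hh
      · intro hh; simp [hi] at hh
    · subst h'
      rw [Finset.sum_eq_single (E i).1]
      · rw [if_pos Sym2.eq_swap]
      · intro b _ hb
        rw [if_neg]
        intro hh
        rw [Sym2.eq_swap (a := (E i).1), Sym2.congr_right] at hh
        exact hb hh
      · intro hh; simp [hi.symm] at hh
    · symm
      apply Finset.sum_eq_zero
      intro u _
      rw [if_neg]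
      intro hh
      rw [Sym2.eq_iff] at hh
      rcases hh with ⟨a, _⟩ | ⟨a, _⟩
      · exact h a.symm
      · exact h' a.symm
  simp_rw [h1]
  rw [Finset.sum_comm]
  refine Finset.sum_congr rfl fun u hu => ?_
  have hu : T.Adj v u := by simpa using hu
  obtain ⟨i, hi⟩ := hsurj s(v, u) hu
  rw [Finset.sum_eq_single i, if_pos hi]
  · intro k _ hk
    rw [if_neg]
    intro hh
    exact hk (hinj (hh.symm.trans hi))
  · simp

/-- side of vertex `v` with respect to the edge `(r,s)`. -/
def auxSide {n : ℕ} (T : SimpleGraph (Fin n)) (E : Fin (n-1) → Fin n × Fin n) :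
    Matrix (Fin n) (Fin (n-1)) ℝ :=
  Matrix.of fun v j => (T.dist (E j).2 v : ℝ) - T.dist (E j).1 v

theorem aux_same {n : ℕ} {T : SimpleGraph (Fin n)} (hT : T.IsTree)
    (E : Fin (n - 1) → Fin n × Fin n)
    (hE : ∀ i, T.Adj (E i).1 (E i).2)
    (hinj : Function.Injective fun i => (s((E i).1, (E i).2) : Sym2 (Fin n)))
    {i j : Fin (n-1)} (hij : i ≠ j) :
    (T.dist (E j).2 (E i).1 = T.dist (E j).1 (E i).1 + 1 ∧
      T.dist (E j).2 (E i).2 = T.dist (E j).1 (E i).2 + 1) ∨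
    (T.dist (E j).1 (E i).1 = T.dist (E j).2 (E i).1 + 1 ∧
      T.dist (E j).1 (E i).2 = T.dist (E j).2 (E i).2 + 1) := by
  have a := hT.dist_eq_dist_add_one_of_adj (E i).1 (hE j)
  have b := hT.dist_eq_dist_add_one_of_adj (E i).2 (hE j)
  simp only [SimpleGraph.dist_comm (u := (E i).1), SimpleGraph.dist_comm (u := (E i).2)] at a b
  rcases a with a | a <;> rcases b with b | b
  · exact Or.inr ⟨a, b⟩
  · obtain ⟨c, d⟩ := aux_cross hT (hE i) (hE j).symm a b
    exact absurd (hinj (by simp only [c, d]; exact Sym2.eq_swap)) hij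
  · obtain ⟨c, d⟩ := aux_cross hT (hE i) (hE j) a b
    exact absurd (hinj (by simp only [c, d])) hij
  · exact Or.inl ⟨a, b⟩

theorem aux_QH {n : ℕ} {T : SimpleGraph (Fin n)} (hT : T.IsTree)
    (E : Fin (n - 1) → Fin n × Fin n)
    (hE : ∀ i, T.Adj (E i).1 (E i).2)
    (hinj : Function.Injective fun i => (s((E i).1, (E i).2) : Sym2 (Fin n)))
    (hsurj : ∀ e ∈ T.edgeSet, ∃ i, e = s((E i).1, (E i).2)) (v : Fin n) (j : Fin (n-1)) :
    (incMat E * orientMat T E) v j = (2 - (degr T v : ℝ)) * auxSide T E v j := by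
  classical
  have a := hT.dist_eq_dist_add_one_of_adj v (hE j)
  simp only [SimpleGraph.dist_comm (u := v)] at a
  have hdj : T.dist (E j).1 (E j).2 = 1 := by simp [hE j]
  have hdj' : T.dist (E j).2 (E j).1 = 1 := by simp [(hE j).symm]
  have h1 : T.dist (E j).1 (E j).1 = 0 := by simp
  have h2 : T.dist (E j).2 (E j).2 = 0 := by simp
  rw [Matrix.mul_apply]
  rcases a with a | a
  · have hv : v ≠ (E j).1 := by rintro rfl; omega
    have key := aux_edgesum E hE hinj hsurj v
      (fun u => ((T.dist (E j).1 u : ℝ) - T.dist (E j).1 v))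
    rw [aux_degsum hT hv] at key
    have : (2 - (degr T v : ℝ)) * auxSide T E v j = ((degr T v : ℝ) - 2) := by
      simp only [auxSide, Matrix.of_apply, a]; push_cast; ring
    rw [this, ← key]
    refine Finset.sum_congr rfl fun i _ => ?_
    simp only [incMat, orientMat, Matrix.of_apply]
    rw [SimpleGraph.dist_comm (u := (E i).1), SimpleGraph.dist_comm (u := (E i).2)]
    by_cases hij : i = j
    · subst hij
      rw [h1, h2, if_pos rfl]
      by_cases c1 : (E i).1 = v
      · subst c1
        simp [hdj, hdj'] at *
      · by_cases c2 : (E i).2 = v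
        · subst c2
          simp [hdj, hdj', c1] at *
        · simp [c1, c2]
    · have t := hT.dist_eq_dist_add_one_of_adj (E j).1 (hE i)
      have u := aux_same hT E hE hinj hij
      by_cases c1 : (E i).1 = v
      · subst c1
        rw [if_pos rfl, if_pos rfl]
        split_ifs with c3
        · have h : (T.dist (E j).1 (E i).2 : ℝ) = T.dist (E j).1 (E i).1 + 1 := by
            have : T.dist (E j).1 (E i).2 = T.dist (E j).1 (E i).1 + 1 := by omega
            exact_mod_cast this
          linarith
        · have h : (T.dist (E j).1 (E i).1 : ℝ) = T.dist (E j).1 (E i).2 + 1 := by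
            have : T.dist (E j).1 (E i).1 = T.dist (E j).1 (E i).2 + 1 := by omega
            exact_mod_cast this
          linarith
      · by_cases c2 : (E i).2 = v
        · subst c2
          rw [if_neg c1, if_pos rfl, if_neg c1, if_pos rfl]
          split_ifs with c3
          · have h : (T.dist (E j).1 (E i).2 : ℝ) = T.dist (E j).1 (E i).1 + 1 := by
              have : T.dist (E j).1 (E i).2 = T.dist (E j).1 (E i).1 + 1 := by omega
              exact_mod_cast this
            linarith
          · have h : (T.dist (E j).1 (E i).1 : ℝ) = T.dist (E j).1 (E i).2 + 1 := by
              have : T.dist (E j).1 (E i).1 = T.dist (E j).1 (E i).2 + 1 := by omega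
              exact_mod_cast this
            linarith
        · simp [c1, c2]
  · have hv : v ≠ (E j).2 := by rintro rfl; omega
    have key := aux_edgesum E hE hinj hsurj v
      (fun u => ((T.dist (E j).2 u : ℝ) - T.dist (E j).2 v))
    rw [aux_degsum hT hv] at key
    have : (2 - (degr T v : ℝ)) * auxSide T E v j = -((degr T v : ℝ) - 2) := by
      simp only [auxSide, Matrix.of_apply, a]; push_cast; ring
    rw [this, ← key, ← Finset.sum_neg_distrib]
    refine Finset.sum_congr rfl fun i _ => ?_
    simp only [incMat, orientMat, Matrix.of_apply]
    rw [SimpleGraph.dist_comm (u := (E i).1), SimpleGraph.dist_comm (u := (E i).2)]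
    by_cases hij : i = j
    · subst hij
      rw [h1, h2, if_pos rfl]
      by_cases c1 : (E i).1 = v
      · subst c1
        simp [hdj, hdj'] at *
      · by_cases c2 : (E i).2 = v
        · subst c2
          simp [hdj, hdj', c1] at *
        · simp [c1, c2]
    · have t := hT.dist_eq_dist_add_one_of_adj (E j).2 (hE i)
      have u := aux_same hT E hE hinj hij
      by_cases c1 : (E i).1 = v
      · subst c1
        rw [if_pos rfl, if_pos rfl]
        split_ifs with c3
        · have h : (T.dist (E j).2 (E i).1 : ℝ) = T.dist (E j).2 (E i).2 + 1 := by
            have : T.dist (E j).2 (E i).1 = T.dist (E j).2 (E i).2 + 1 := by omega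
            exact_mod_cast this
          linarith
        · have h : (T.dist (E j).2 (E i).2 : ℝ) = T.dist (E j).2 (E i).1 + 1 := by
            have : T.dist (E j).2 (E i).2 = T.dist (E j).2 (E i).1 + 1 := by omega
            exact_mod_cast this
          linarith
      · by_cases c2 : (E i).2 = v
        · subst c2
          rw [if_neg c1, if_pos rfl, if_neg c1, if_pos rfl]
          split_ifs with c3
          · have h : (T.dist (E j).2 (E i).1 : ℝ) = T.dist (E j).2 (E i).2 + 1 := by
              have : T.dist (E j).2 (E i).1 = T.dist (E j).2 (E i).2 + 1 := by omega
              exact_mod_cast this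
            linarith
          · have h : (T.dist (E j).2 (E i).2 : ℝ) = T.dist (E j).2 (E i).1 + 1 := by
              have : T.dist (E j).2 (E i).2 = T.dist (E j).2 (E i).1 + 1 := by omega
              exact_mod_cast this
            linarith
        · simp [c1, c2]

theorem stmt7 {n : ℕ} (T : SimpleGraph (Fin n)) (hT : T.IsTree)
    (E : Fin (n - 1) → Fin n × Fin n)
    (hE : ∀ i, T.Adj (E i).1 (E i).2)
    (hinj : Function.Injective fun i => (s((E i).1, (E i).2) : Sym2 (Fin n)))
    (hsurj : ∀ e ∈ T.edgeSet, ∃ i, e = s((E i).1, (E i).2))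
    (hdeg : ∀ v, degr T v ≠ 2) :
    (orientMat T E).det ≠ 0 ∧
      (orientMat T E)⁻¹
        = (1 / 2 : ℝ) • ((incMat E)ᵀ * Matrix.diagonal (fun v => (2 - (degr T v : ℝ))⁻¹) * incMat E) := by
  have hτ : ∀ v, (2 - (degr T v : ℝ)) ≠ 0 := by
    intro v h
    apply hdeg v
    have : (degr T v : ℝ) = 2 := by linarith
    exact_mod_cast this
  have h1 : Matrix.diagonal (fun v => (2 - (degr T v : ℝ))⁻¹) * (incMat E * orientMat T E)
      = auxSide T E := by
    ext v j
    rw [Matrix.diagonal_mul, aux_QH hT E hE hinj hsurj, inv_mul_cancel_left₀ (hτ v)]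
  have h2 : (incMat E)ᵀ * auxSide T E = (2 : ℝ) • 1 := by
    ext k j
    rw [Matrix.mul_apply]
    have : ∀ v, (incMat E)ᵀ k v * auxSide T E v j =
        (if (E k).1 = v then auxSide T E v j else 0) -
        (if (E k).2 = v then auxSide T E v j else 0) := by
      intro v
      simp only [Matrix.transpose_apply, incMat, Matrix.of_apply]
      have := (hE k).ne
      split_ifs with a b b
      · exact absurd (a.trans b.symm) this
      all_goals ring
    simp_rw [this]
    rw [Finset.sum_sub_distrib, Finset.sum_ite_eq, Finset.sum_ite_eq]
    simp only [Finset.mem_univ, if_true, auxSide, Matrix.of_apply, Matrix.smul_apply, smul_eq_mul]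
    by_cases hkj : k = j
    · subst hkj
      have hdj : T.dist (E k).1 (E k).2 = 1 := by simp [hE k]
      have hdj' : T.dist (E k).2 (E k).1 = 1 := by simp [(hE k).symm]
      rw [hdj, hdj']
      simp
      norm_num
    · rw [Matrix.one_apply_ne hkj]
      rcases aux_same hT E hE hinj hkj with ⟨a, b⟩ | ⟨a, b⟩
      · rw [a, b]; push_cast; ring
      · rw [a, b]; push_cast; ring
  have h3 : ((1 / 2 : ℝ) • ((incMat E)ᵀ * Matrix.diagonal (fun v => (2 - (degr T v : ℝ))⁻¹)
      * incMat E)) * orientMat T E = 1 := by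
    rw [Matrix.smul_mul, Matrix.mul_assoc, Matrix.mul_assoc, h1, h2, smul_smul]
    norm_num
  refine ⟨?_, Matrix.inv_eq_left_inv h3⟩
  have := congrArg Matrix.det h3
  rw [Matrix.det_mul, Matrix.det_one] at this
  exact right_ne_zero_of_mul_eq_one this
end
end

section
/- Let T be a tree with vertex set {1,...,n} whose edges e_1,...,e_{n-1} are assigned nonzero real weights w_1,...,w_{n-1}, with an orientation assigned to each edge. Let Δ be the squared distance matrix of T, Q the oriented vertex-edge incidence matrix, H the edge orientation matrix (with the same orientation as Q), and F the diagonal matrix with diagonal entries w_1,...,w_{n-1}. Then Q' Δ Q = -2 F H F. -/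
open Finset Matrix

noncomputable section

/-- Edge list of the chosen path. -/
def pE {n : ℕ} (T : SimpleGraph (Fin n)) (hc : T.Connected) (u v : Fin n) :
    List (Sym2 (Fin n)) :=
  ((Nonempty.some (hc.preconnected u v)).toPath : T.Walk u v).edges

theorem pE_eq {n : ℕ} {T : SimpleGraph (Fin n)} (hT : T.IsTree) {u v : Fin n}
    (p : T.Walk u v) (hp : p.IsPath) : pE T hT.isConnected u v = p.edges := by
  unfold pE
  have := hT.isAcyclic.path_unique
    ((Nonempty.some (hT.isConnected.preconnected u v)).toPath) ⟨p, hp⟩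
  rw [this]

theorem pE_walk {n : ℕ} {T : SimpleGraph (Fin n)} (hT : T.IsTree) (u v : Fin n) :
    ∃ p : T.Walk u v, p.IsPath ∧ pE T hT.isConnected u v = p.edges :=
  ⟨_, ((Nonempty.some (hT.isConnected.preconnected u v)).toPath).2, rfl⟩

theorem pE_length {n : ℕ} {T : SimpleGraph (Fin n)} (hT : T.IsTree) (u v : Fin n) :
    (pE T hT.isConnected u v).length = T.dist u v := by
  obtain ⟨p, hp, hl⟩ := hT.isConnected.exists_path_of_dist u v
  rw [pE_eq hT p hp, SimpleGraph.Walk.length_edges, hl]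

theorem pE_self {n : ℕ} {T : SimpleGraph (Fin n)} (hT : T.IsTree) (u : Fin n) :
    pE T hT.isConnected u u = [] := by
  rw [pE_eq hT SimpleGraph.Walk.nil (by simp)]; simp

theorem pE_rev {n : ℕ} {T : SimpleGraph (Fin n)} (hT : T.IsTree) (u v : Fin n) :
    pE T hT.isConnected u v = (pE T hT.isConnected v u).reverse := by
  obtain ⟨p, hp, h⟩ := pE_walk hT v u
  rw [h, pE_eq hT p.reverse hp.reverse, SimpleGraph.Walk.edges_reverse]

theorem pE_nodup {n : ℕ} {T : SimpleGraph (Fin n)} (hT : T.IsTree) (u v : Fin n) :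
    (pE T hT.isConnected u v).Nodup := by
  obtain ⟨p, hp, h⟩ := pE_walk hT u v
  rw [h]; exact hp.isTrail.edges_nodup

theorem pE_adj {n : ℕ} {T : SimpleGraph (Fin n)} (hT : T.IsTree) {p q : Fin n}
    (h : T.Adj p q) (r : Fin n) :
    (pE T hT.isConnected q r = s(p, q) :: pE T hT.isConnected p r) ∨
    (pE T hT.isConnected p r = s(p, q) :: pE T hT.isConnected q r) := by
  obtain ⟨x, hx, hxe⟩ := pE_walk hT p r
  by_cases hq : q ∈ x.support
  · right
    have h1 : (x.dropUntil q hq).IsPath := hx.dropUntil hq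
    have h2 : (x.takeUntil q hq).IsPath := hx.takeUntil hq
    have h3 := pE_eq hT _ h1
    have h4 := pE_eq hT _ h2
    have h5 : (SimpleGraph.Walk.cons h SimpleGraph.Walk.nil).IsPath := by
      simp [h.ne]
    have h6 := pE_eq hT _ h5
    have h7 := congrArg SimpleGraph.Walk.edges (x.take_spec hq)
    rw [SimpleGraph.Walk.edges_append, ← h3, ← h4, h6] at h7
    rw [hxe, ← h7]; simp
  · left
    have h1 : (SimpleGraph.Walk.cons h.symm x).IsPath := by
      simp [SimpleGraph.Walk.cons_isPath_iff, hx, hq]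
    rw [pE_eq hT _ h1, hxe, SimpleGraph.Walk.edges_cons, Sym2.eq_swap]

theorem pE_mem {n : ℕ} {T : SimpleGraph (Fin n)} (hT : T.IsTree) {p r s : Fin n}
    (h : T.Adj r s) (e : Sym2 (Fin n)) (he : e ≠ s(r, s)) :
    e ∈ pE T hT.isConnected p r ↔ e ∈ pE T hT.isConnected p s := by
  rw [pE_rev hT p r, pE_rev hT p s]
  rcases pE_adj hT h p with h1 | h1 <;> simp [h1, he]

/-- Both ends of a second edge see the first edge from the same side. -/
theorem pE_adj2 {n : ℕ} {T : SimpleGraph (Fin n)} (hT : T.IsTree) {p q r s : Fin n}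
    (h : T.Adj p q) (h' : T.Adj r s) (hne : s(p, q) ≠ s(r, s)) :
    ((pE T hT.isConnected q r = s(p, q) :: pE T hT.isConnected p r) ∧
     (pE T hT.isConnected q s = s(p, q) :: pE T hT.isConnected p s)) ∨
    ((pE T hT.isConnected p r = s(p, q) :: pE T hT.isConnected q r) ∧
     (pE T hT.isConnected p s = s(p, q) :: pE T hT.isConnected q s)) := by
  have m1 := pE_mem hT (p := p) h' _ hne
  have m2 := pE_mem hT (p := q) h' _ hne
  have n1 := pE_nodup hT q r
  have n2 := pE_nodup hT p r
  rcases pE_adj hT h r with h1 | h1 <;> rcases pE_adj hT h s with h2 | h2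
  · exact Or.inl ⟨h1, h2⟩
  · rw [h1] at n1; rw [h2] at m1
    simp at n1 m1; exact absurd m1 n1.1
  · rw [h1] at n2; rw [h2] at m2
    simp at n2 m2; exact absurd m2 n2.1
  · exact Or.inr ⟨h1, h2⟩

theorem incMat_sum {n : ℕ} (E : Fin (n-1) → Fin n × Fin n) (i : Fin (n-1))
    (h : (E i).1 ≠ (E i).2) (f : Fin n → ℝ) :
    ∑ v, incMat E v i * f v = f (E i).1 - f (E i).2 := by
  have : ∀ v, incMat E v i * f v =
      (if (E i).1 = v then f v else 0) - (if (E i).2 = v then f v else 0) := by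
    intro v
    simp only [incMat, Matrix.of_apply]
    split_ifs with h1 h2
    · exact absurd (h1.trans h2.symm) h
    all_goals ring
  simp [this, Finset.sum_sub_distrib]

theorem stmt8 {n : ℕ} (T : SimpleGraph (Fin n)) (hT : T.IsTree)
    (E : Fin (n - 1) → Fin n × Fin n) (w : Fin (n - 1) → ℝ)
    (hw : ∀ i, w i ≠ 0)
    (hE : ∀ i, T.Adj (E i).1 (E i).2)
    (hinj : Function.Injective fun i => (s((E i).1, (E i).2) : Sym2 (Fin n)))
    (hsurj : ∀ e ∈ T.edgeSet, ∃ i, e = s((E i).1, (E i).2)) :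
    (incMat E)ᵀ * sqDistMat T hT.isConnected E w * incMat E
      = (-2 : ℝ) • (Matrix.diagonal w * orientMat T E * Matrix.diagonal w) := by
  classical
  set f : Sym2 (Fin n) → ℝ :=
    fun s => ∑ i : Fin (n-1), if s = s((E i).1, (E i).2) then w i else 0 with hf
  have hfe : ∀ i, f s((E i).1, (E i).2) = w i := by
    intro i
    have : ∀ k, (s((E i).1, (E i).2) = s((E k).1, (E k).2)) ↔ i = k :=
      fun k => ⟨fun h => hinj h, fun h => by rw [h]⟩
    simp only [hf, this]
    simp
  have hwd : ∀ u v, wdist T hT.isConnected E w u v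
      = ((pE T hT.isConnected u v).map f).sum := fun u v => rfl
  ext i j
  rw [Matrix.mul_apply]
  have e1 : ∀ v, ((incMat E)ᵀ * sqDistMat T hT.isConnected E w) i v
      = (wdist T hT.isConnected E w (E i).1 v)^2 - (wdist T hT.isConnected E w (E i).2 v)^2 := by
    intro v
    rw [Matrix.mul_apply]
    simp only [Matrix.transpose_apply]
    rw [incMat_sum E i (hE i).ne]
    rfl
  simp only [e1]
  simp only [mul_comm _ (incMat E _ j)]
  rw [incMat_sum E j (hE j).ne]
  simp only [Matrix.smul_apply, Matrix.mul_diagonal, Matrix.diagonal_mul, orientMat,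
    Matrix.of_apply, smul_eq_mul, hwd, ← pE_length hT]
  by_cases hij : i = j
  · subst hij
    have h1 : pE T hT.isConnected (E i).1 (E i).2 = [s((E i).1, (E i).2)] := by
      rw [pE_eq hT (SimpleGraph.Walk.cons (hE i) SimpleGraph.Walk.nil) (by simp [(hE i).ne])]
      simp
    rw [pE_rev hT (E i).2 (E i).1, h1, pE_self hT, pE_self hT]
    simp [hfe]
    ring
  · have hne : s((E i).1, (E i).2) ≠ s((E j).1, (E j).2) := fun h => hij (hinj h)
    have key := pE_adj2 hT (hE i) (hE j) hne
    have key2 := pE_adj2 hT (hE j) (hE i) hne.symm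
    have hi := hfe i
    have hj := hfe j
    generalize (E i).1 = p at *
    generalize (E i).2 = q at *
    generalize (E j).1 = r at *
    generalize (E j).2 = s at *
    have sy : ∀ u v, ((pE T hT.isConnected u v).map f).sum
        = ((pE T hT.isConnected v u).map f).sum := by
      intro u v; rw [pE_rev hT u v, List.map_reverse, List.sum_reverse]
    have sl : ∀ u v, (pE T hT.isConnected u v).length
        = (pE T hT.isConnected v u).length := by
      intro u v; rw [pE_rev hT u v, List.length_reverse]
    have S : ∀ {u v u' v' e}, pE T hT.isConnected u v = e :: pE T hT.isConnected u' v' →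
        ((pE T hT.isConnected u v).map f).sum = f e + ((pE T hT.isConnected u' v').map f).sum ∧
        (pE T hT.isConnected u v).length = (pE T hT.isConnected u' v').length + 1 := by
      intro u v u' v' e h; rw [h]; simp
    have y1 := sy r p
    have y2 := sy s p
    have y3 := sy r q
    have y4 := sy s q
    have l1 := sl r p
    have l2 := sl s p
    have l3 := sl r q
    have l4 := sl s q
    rcases key with ⟨a, b⟩ | ⟨a, b⟩ <;> rcases key2 with ⟨c, d⟩ | ⟨c, d⟩ <;>
    · obtain ⟨a1, a2⟩ := S a
      obtain ⟨b1, b2⟩ := S b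
      obtain ⟨c1, c2⟩ := S c
      obtain ⟨d1, d2⟩ := S d
      clear a b c d S sy sl
      rw [hi] at a1 b1
      rw [hj] at c1 d1
      rw [y1, y2] at c1
      rw [y3, y4] at d1
      clear y1 y2 y3 y4
      split_ifs with hh
      all_goals first
        | omega
        | (rw [a1, b1, c1]; ring1)
        | (rw [a1, b1, d1]; ring1)

end
end

section
/- Let T be a tree with vertex set {1,...,n} whose edges are assigned nonzero real weights. Let Δ be the squared distance matrix, D the weighted distance matrix, and L the weighted Laplacian of T; let τ̃ be the diagonal matrix with diagonal entries τ_1,...,τ_n where τ_i = 2 - δ_i (δ_i the degree of vertex i), and let δ̂ be the vector of weighted degrees. Then Δ L = 2 D τ̃ - 𝟙 δ̂', where 𝟙 is the all-ones vector. -/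
open Finset Matrix

noncomputable section

/-- The weight of an unordered pair. -/
def wt {n : ℕ} (E : Fin (n-1) → Fin n × Fin n) (w : Fin (n-1) → ℝ) (s : Sym2 (Fin n)) : ℝ :=
  ∑ i : Fin (n-1), if s = s((E i).1, (E i).2) then w i else 0

lemma wt_edge {n : ℕ} (E : Fin (n - 1) → Fin n × Fin n) (w : Fin (n - 1) → ℝ)
    (hinj : Function.Injective fun i => (s((E i).1, (E i).2) : Sym2 (Fin n)))
    (k : Fin (n-1)) : wt E w s((E k).1, (E k).2) = w k := by
  unfold wt
  rw [Finset.sum_eq_single k]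
  · simp
  · intro b _ hb
    rw [if_neg]
    intro h
    exact hb (hinj h.symm)
  · simp

lemma wdist_path {n : ℕ} (T : SimpleGraph (Fin n)) (hT : T.IsTree)
    (E : Fin (n-1) → Fin n × Fin n) (w : Fin (n-1) → ℝ) {u v : Fin n}
    (p : T.Walk u v) (hp : p.IsPath) :
    wdist T hT.isConnected E w u v = (p.edges.map (wt E w)).sum := by
  unfold wdist
  rw [hT.isAcyclic.path_unique (Nonempty.some (hT.isConnected.preconnected u v)).toPath ⟨p, hp⟩]
  rfl

lemma wdist_self {n : ℕ} (T : SimpleGraph (Fin n)) (hT : T.IsTree)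
    (E : Fin (n-1) → Fin n × Fin n) (w : Fin (n-1) → ℝ) (u : Fin n) :
    wdist T hT.isConnected E w u u = 0 := by
  rw [wdist_path T hT E w SimpleGraph.Walk.nil (by simp)]
  simp

lemma wdist_concat {n : ℕ} (T : SimpleGraph (Fin n)) (hT : T.IsTree)
    (E : Fin (n-1) → Fin n × Fin n) (w : Fin (n-1) → ℝ) {u v x : Fin n}
    (p : T.Walk u v) (hp : p.IsPath) (h : T.Adj v x) (hx : x ∉ p.support) :
    wdist T hT.isConnected E w u x = wdist T hT.isConnected E w u v + wt E w s(v, x) := by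
  rw [wdist_path T hT E w p hp, wdist_path T hT E w (p.concat h) (hp.concat hx h)]
  simp [SimpleGraph.Walk.edges_concat]

/-- Every vertex other than the root has a parent; the other neighbours are children. -/
lemma exists_parent {n : ℕ} (T : SimpleGraph (Fin n)) (hT : T.IsTree)
    (E : Fin (n-1) → Fin n × Fin n) (w : Fin (n-1) → ℝ) {u v : Fin n} (huv : u ≠ v) :
    ∃ q, T.Adj v q ∧
      wdist T hT.isConnected E w u v = wdist T hT.isConnected E w u q + wt E w s(v, q) ∧
      ∀ x, T.Adj v x → x ≠ q →
        wdist T hT.isConnected E w u x = wdist T hT.isConnected E w u v + wt E w s(v, x) := by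
  obtain ⟨p, hp, -⟩ := hT.existsUnique_path u v
  have hn : ¬ p.Nil := SimpleGraph.Walk.not_nil_of_ne huv
  have ha := p.adj_penultimate hn
  refine ⟨p.penultimate, ha.symm, ?_, ?_⟩
  · have hc := p.concat_dropLast ha
    have h2 := hp
    rw [← hc, SimpleGraph.Walk.concat_isPath_iff] at h2
    rw [Sym2.eq_swap]
    exact wdist_concat T hT E w _ h2.1 ha h2.2
  · intro x hx hne
    exact wdist_concat T hT E w p hp hx
      (fun hs => hne (hT.isAcyclic.eq_penultimate_of_adj_end hp hx hs))

open Classical in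
lemma sum_incident {n : ℕ} (T : SimpleGraph (Fin n))
    (E : Fin (n - 1) → Fin n × Fin n) (w : Fin (n - 1) → ℝ)
    (hE : ∀ i, T.Adj (E i).1 (E i).2)
    (hinj : Function.Injective fun i => (s((E i).1, (E i).2) : Sym2 (Fin n)))
    (hsurj : ∀ e ∈ T.edgeSet, ∃ i, e = s((E i).1, (E i).2)) (f : ℝ → ℝ) (v : Fin n) :
    ∑ k ∈ univ.filter (fun k => (E k).1 = v ∨ (E k).2 = v), f (w k)
      = ∑ x ∈ univ.filter (fun x => T.Adj v x), f (wt E w s(v, x)) := by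
  have key : ∀ k, ((E k).1 = v ∨ (E k).2 = v) →
      s((E k).1, (E k).2) = s(v, if (E k).1 = v then (E k).2 else (E k).1) := by
    intro k hk
    split_ifs with h
    · rw [h]
    · rw [hk.resolve_left h, Sym2.eq_swap]
  refine Finset.sum_bij (fun k _ => if (E k).1 = v then (E k).2 else (E k).1) ?_ ?_ ?_ ?_
  · intro k hk
    simp only [mem_filter, mem_univ, true_and] at hk ⊢
    rw [← SimpleGraph.mem_edgeSet, ← key k hk]
    exact hE k
  · intro k hk l hl h
    simp only [mem_filter, mem_univ, true_and] at hk hl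
    apply hinj
    dsimp only at h ⊢
    rw [key k hk, key l hl, h]
  · intro x hx
    simp only [mem_filter, mem_univ, true_and] at hx
    obtain ⟨k, hk⟩ := hsurj s(v, x) hx
    have hi : (E k).1 = v ∨ (E k).2 = v := by
      have : v ∈ s((E k).1, (E k).2) := by rw [← hk]; simp
      rw [Sym2.mem_iff] at this
      exact this.imp Eq.symm Eq.symm
    refine ⟨k, by simpa using hi, ?_⟩
    have := key k hi
    rw [← hk] at this
    exact (Sym2.congr_right.mp this).symm
  · intro k hk
    simp only [mem_filter, mem_univ, true_and] at hk
    rw [← key k hk, wt_edge E w hinj]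

open Classical in
lemma sum_between {n : ℕ} (T : SimpleGraph (Fin n))
    (E : Fin (n - 1) → Fin n × Fin n) (w : Fin (n - 1) → ℝ)
    (hE : ∀ i, T.Adj (E i).1 (E i).2)
    (hinj : Function.Injective fun i => (s((E i).1, (E i).2) : Sym2 (Fin n)))
    (hsurj : ∀ e ∈ T.edgeSet, ∃ i, e = s((E i).1, (E i).2)) (i v : Fin n) :
    ∑ k ∈ univ.filter (fun k => E k = (i, v) ∨ E k = (v, i)), (w k)⁻¹
      = if T.Adj v i then (wt E w s(v, i))⁻¹ else 0 := by
  have key : ∀ k, (E k = (i, v) ∨ E k = (v, i)) ↔ s((E k).1, (E k).2) = s(v, i) := by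
    intro k
    rw [Sym2.eq_iff, Prod.ext_iff, Prod.ext_iff]
    tauto
  simp only [key]
  split_ifs with h
  · obtain ⟨k, hk⟩ := hsurj s(v, i) h
    rw [hk, wt_edge E w hinj, Finset.sum_eq_single k]
    · intro b hb hne
      simp only [mem_filter, mem_univ, true_and] at hb
      exact absurd (hinj hb) hne
    · simp
  · apply Finset.sum_eq_zero
    intro k hk
    simp only [mem_filter, mem_univ, true_and] at hk
    exact absurd (by rw [← SimpleGraph.mem_edgeSet, ← hk]; exact hE k) h

open Classical in
lemma sum_lap {n : ℕ} (T : SimpleGraph (Fin n))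
    (E : Fin (n - 1) → Fin n × Fin n) (w : Fin (n - 1) → ℝ)
    (hE : ∀ i, T.Adj (E i).1 (E i).2)
    (hinj : Function.Injective fun i => (s((E i).1, (E i).2) : Sym2 (Fin n)))
    (hsurj : ∀ e ∈ T.edgeSet, ∃ i, e = s((E i).1, (E i).2)) (g : Fin n → ℝ) (v : Fin n) :
    ∑ i, g i * lap E w i v
      = ∑ x ∈ univ.filter (fun x => T.Adj v x), (g v - g x) * (wt E w s(v, x))⁻¹ := by
  have h1 : ∀ i, g i * lap E w i v =
      (if i = v then g v * ∑ x ∈ univ.filter (fun x => T.Adj v x), (wt E w s(v, x))⁻¹ else 0)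
      - (if T.Adj v i then g i * (wt E w s(v, i))⁻¹ else 0) := by
    intro i
    simp only [lap, Matrix.of_apply]
    by_cases h : i = v
    · subst h
      simp [sum_incident T E w hE hinj hsurj (fun t => t⁻¹)]
    · rw [if_neg h, if_neg h, sum_between T E w hE hinj hsurj]
      split_ifs <;> ring
  simp only [h1, Finset.sum_sub_distrib, sub_mul, Finset.sum_ite_eq', mem_univ, if_true,
    Finset.sum_filter, Finset.mul_sum, Finset.sum_ite_eq, Finset.mul_sum]
  congr 1
  simp

theorem stmt9 {n : ℕ} (T : SimpleGraph (Fin n)) (hT : T.IsTree)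
    (E : Fin (n - 1) → Fin n × Fin n) (w : Fin (n - 1) → ℝ)
    (hw : ∀ i, w i ≠ 0)
    (hE : ∀ i, T.Adj (E i).1 (E i).2)
    (hinj : Function.Injective fun i => (s((E i).1, (E i).2) : Sym2 (Fin n)))
    (hsurj : ∀ e ∈ T.edgeSet, ∃ i, e = s((E i).1, (E i).2)) :
    sqDistMat T hT.isConnected E w * lap E w
      = (2 : ℝ) • (distMat T hT.isConnected E w * Matrix.diagonal (fun v => 2 - (degr T v : ℝ)))
        - Matrix.vecMulVec (fun _ => (1 : ℝ)) (wdeg E w) := by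
  classical
  ext u v
  have hW : ∀ x, T.Adj v x → wt E w s(v, x) ≠ 0 := by
    intro x hx
    obtain ⟨k, hk⟩ := hsurj s(v, x) hx
    rw [hk, wt_edge E w hinj]
    exact hw k
  have hdeg : (degr T v : ℝ) = ∑ x ∈ univ.filter (fun x => T.Adj v x), (1 : ℝ) := by
    unfold degr
    rw [Finset.sum_const, nsmul_eq_mul, mul_one, Set.ncard_eq_toFinset_card']
    congr 2
    ext x
    simp
  have hwd : wdeg E w v = ∑ x ∈ univ.filter (fun x => T.Adj v x), wt E w s(v, x) :=
    sum_incident T E w hE hinj hsurj (fun t => t) v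
  rw [Matrix.mul_apply]
  simp only [sqDistMat, distMat, Matrix.of_apply, Matrix.sub_apply, Matrix.smul_apply,
    Matrix.mul_diagonal, Matrix.vecMulVec_apply, smul_eq_mul, one_mul]
  rw [sum_lap T E w hE hinj hsurj (fun i => wdist T hT.isConnected E w u i ^ 2) v, hdeg, hwd]
  by_cases huv : u = v
  · subst huv
    rw [wdist_self T hT, ← sub_eq_zero]
    simp only [zero_mul, mul_zero, zero_sub, sub_neg_eq_add]
    rw [← Finset.sum_add_distrib]
    apply Finset.sum_eq_zero
    intro x hx
    simp only [mem_filter, mem_univ, true_and] at hx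
    have := wdist_concat T hT E w (SimpleGraph.Walk.nil : T.Walk u u) (by simp) hx
      (by simpa using hx.ne')
    rw [this, wdist_self T hT]
    have := hW x hx
    field_simp
    ring
  · obtain ⟨q, hq, hd, hc⟩ := exists_parent T hT E w huv
    have hqm : q ∈ univ.filter (fun x => T.Adj v x) := by simpa using hq
    rw [← Finset.add_sum_erase _ _ hqm, ← Finset.add_sum_erase _ _ hqm,
      ← Finset.add_sum_erase _ _ hqm]
    have hs : ∑ x ∈ (univ.filter (fun x => T.Adj v x)).erase q,
        (wdist T hT.isConnected E w u v ^ 2 - wdist T hT.isConnected E w u x ^ 2)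
          * (wt E w s(v, x))⁻¹
        = ∑ x ∈ (univ.filter (fun x => T.Adj v x)).erase q,
          (-2 * wdist T hT.isConnected E w u v * 1 - wt E w s(v, x)) := by
      apply Finset.sum_congr rfl
      intro x hx
      simp only [mem_erase, mem_filter, mem_univ, true_and] at hx
      rw [hc x hx.2 hx.1]
      have := hW x hx.2
      field_simp
      ring
    rw [hs, Finset.sum_sub_distrib, ← Finset.mul_sum]
    have hq0 := hW q hq
    have hq1 : (wdist T hT.isConnected E w u v ^ 2 - wdist T hT.isConnected E w u q ^ 2)
        * (wt E w s(v, q))⁻¹ = 2 * wdist T hT.isConnected E w u v - wt E w s(v, q) := by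
      rw [eq_sub_of_add_eq hd.symm]
      field_simp
      ring
    rw [hq1]
    ring

end
end
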